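/- General bistochastic interconversion: let p and q be probability vectors of dimension d with D(p) > 0, D(q) > 0, V(p) > 0, V(q) > 0, and let μ ∈ ℝ. Define R_μ(n) := (1/D(q))·[D(p) + μ·√(D(p)·V(q)/(D(q)·n))], m_n := ⌊n·R_μ(n)⌋, and the optimal interconversion infidelity ε*_0(n) := min{ ε ∈ [0,1] : p^{⊗n} ⊗ η^{⊗m_n} ≻_ε q^{⊗m_n} ⊗ η^{⊗n} }. Then lim_{n→∞} ε*_0(n) = Z_ν(μ), where ν := (V(p)/D(p))/(V(q)/D(q)) and Z_ν(μ) := 1 − sup_A (∫_ℝ √(A′(x)·Φ′_{μ,ν}(x)) dx)², the supremum being over all monotone increasing, continuously differentiable functions A : ℝ → [0,1] with A(x) ≥ Φ(x) for all x. -/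

import Mathlib

open Finset Filter

noncomputable section

/-- A probability vector: nonnegative entries summing to 1. -/
def IsProbVec {ι : Type*} [Fintype ι] (p : ι → ℝ) : Prop :=
  (∀ i, 0 ≤ p i) ∧ ∑ i, p i = 1

/-- The sum of the `k` largest entries of `p`: the largest sum over subsets of at
most `k` indices (for nonnegative vectors this equals the sorted partial sum,
with zero padding beyond the dimension). -/
def kMaxSum {ι : Type*} [Fintype ι] (p : ι → ℝ) (k : ℕ) : ℝ :=
  (Finset.univ.powerset.filter (fun s : Finset ι => s.card ≤ k)).sup'
    ⟨∅, by simp⟩ (fun s => ∑ i ∈ s, p i)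

/-- `p ≻ q`: for every `k`, the sum of the `k` largest entries of `p` is at least
that of `q` (dimensions may differ, the shorter padded with zeros). -/
def Majorises {ι κ : Type*} [Fintype ι] [Fintype κ] (p : ι → ℝ) (q : κ → ℝ) : Prop :=
  ∀ k : ℕ, kMaxSum q k ≤ kMaxSum p k

/-- Fidelity `F(p,q) = (Σ_i √(p_i q_i))²`. -/
def fidelity {ι : Type*} [Fintype ι] (p q : ι → ℝ) : ℝ :=
  (∑ i, Real.sqrt (p i * q i)) ^ 2

/-- Infidelity `δ(p,q) = 1 - F(p,q)`. -/
def infid {ι : Type*} [Fintype ι] (p q : ι → ℝ) : ℝ := 1 - fidelity p q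

/-- The `n`-fold tensor (Kronecker) power of `a`, as a vector indexed by
`Fin n → Fin d` (a probability vector of dimension `d^n`). -/
def tensorPow {d : ℕ} (a : Fin d → ℝ) (n : ℕ) : (Fin n → Fin d) → ℝ :=
  fun f => ∏ j, a (f j)

/-- Shannon entropy `H(p) = -Σ_i p_i log p_i`. -/
def shannonH {ι : Type*} [Fintype ι] (p : ι → ℝ) : ℝ := -∑ i, p i * Real.log (p i)

/-- Entropy variance `V(p) = Σ_i p_i (-log p_i - H(p))²`. -/
def entVar {ι : Type*} [Fintype ι] (p : ι → ℝ) : ℝ :=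
  ∑ i, p i * (-Real.log (p i) - shannonH p) ^ 2

/-- Relative entropy to the uniform distribution: `D(p) = log d - H(p)`. -/
def relD {d : ℕ} (p : Fin d → ℝ) : ℝ := Real.log d - shannonH p

/-- Density of the normal distribution with mean `μ` and variance `v`. -/
def normPDF (μ v x : ℝ) : ℝ :=
  Real.exp (-((x - μ) ^ 2) / (2 * v)) / Real.sqrt (2 * Real.pi * v)

/-- Cumulative distribution function `Φ_{μ,v}` of the normal distribution. -/
def normCDF (μ v x : ℝ) : ℝ := ∫ t in Set.Iic x, normPDF μ v t

/-- The standard normal cumulative distribution function `Φ`. -/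
def Phi (x : ℝ) : ℝ := normCDF 0 1 x

/-- A vector is flat if all of its non-zero entries are equal. -/
def IsFlat {ι : Type*} [Fintype ι] (p : ι → ℝ) : Prop :=
  ∀ i j, p i ≠ 0 → p j ≠ 0 → p i = p j

/-- `P ≻_ε Q`: `P` ε-post-majorises `Q`, i.e. there is a probability vector `Q̃`
with `P ≻ Q̃` and `δ(Q,Q̃) ≤ ε`. -/
def PostMaj {ι κ : Type*} [Fintype ι] [Fintype κ] (ε : ℝ) (P : ι → ℝ) (Q : κ → ℝ) : Prop :=
  ∃ Qt : κ → ℝ, IsProbVec Qt ∧ Majorises P Qt ∧ infid Q Qt ≤ ε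

/-- The cumulative Rayleigh-normal distribution
`Z_ν(μ) = 1 - sup_{A ≥ Φ} F(A', Φ'_{μ,ν})`, the supremum being over monotone
increasing, continuously differentiable `A : ℝ → [0,1]` with `A ≥ Φ` pointwise. -/
def Zray (ν μ : ℝ) : ℝ :=
  1 - sSup {y : ℝ | ∃ A : ℝ → ℝ, Monotone A ∧ ContDiff ℝ 1 A ∧
      (∀ x, A x ≤ 1) ∧ (∀ x, Phi x ≤ A x) ∧
      y = (∫ x : ℝ, Real.sqrt (deriv A x * normPDF μ ν x)) ^ 2}

section Majorisation

variable {ι κ : Type*} [Fintype ι] [Fintype κ]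

lemma sum_le_kMaxSum (p : ι → ℝ) {k : ℕ} {s : Finset ι} (hs : s.card ≤ k) :
    ∑ i ∈ s, p i ≤ kMaxSum p k :=
  Finset.le_sup' (fun s : Finset ι => ∑ i ∈ s, p i) (by simpa using hs)

lemma kMaxSum_le {p : ι → ℝ} {k : ℕ} {c : ℝ}
    (h : ∀ s : Finset ι, s.card ≤ k → ∑ i ∈ s, p i ≤ c) : kMaxSum p k ≤ c :=
  Finset.sup'_le _ _ fun s hs => h s (by simpa using hs)

lemma kMaxSum_comp_equiv (p : ι → ℝ) (e : κ ≃ ι) (k : ℕ) : kMaxSum (p ∘ e) k = kMaxSum p k := by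
  refine le_antisymm (kMaxSum_le fun s hs => ?_) (kMaxSum_le fun s hs => ?_)
  · have := sum_le_kMaxSum p (s := s.map e.toEmbedding) (by simpa using hs)
    simpa using this
  · have := sum_le_kMaxSum (p ∘ e) (s := s.map e.symm.toEmbedding) (by simpa using hs)
    simpa using this

lemma kMaxSum_le_one {p : ι → ℝ} (hp : IsProbVec p) (k : ℕ) : kMaxSum p k ≤ 1 :=
  kMaxSum_le fun s _ => hp.2 ▸ Finset.sum_le_sum_of_subset_of_nonneg (Finset.subset_univ s)
    fun i _ _ => hp.1 i

lemma kMaxSum_zero (p : ι → ℝ) : kMaxSum p 0 = 0 := by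
  refine le_antisymm (kMaxSum_le fun s hs => ?_) ?_
  · simp [Finset.card_eq_zero.1 (Nat.le_zero.1 hs)]
  · simpa using sum_le_kMaxSum p (k := 0) (s := ∅) (by simp)

lemma kMaxSum_mono (p : ι → ℝ) {k l : ℕ} (h : k ≤ l) : kMaxSum p k ≤ kMaxSum p l :=
  kMaxSum_le fun _ hs => sum_le_kMaxSum p (hs.trans h)

lemma kMaxSum_le_sum_antitone {N : ℕ} {p : Fin N → ℝ} (hp : ∀ i, 0 ≤ p i) (ha : Antitone p)
    (k : ℕ) : kMaxSum p k ≤ ∑ i, if i.val < k then p i else 0 := by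
  refine kMaxSum_le fun s hs => ?_
  by_cases hk : k < N
  · set τ := p ⟨k, hk⟩
    have h1 : ∑ i ∈ s, p i ≤ ∑ i ∈ s, (max (p i - τ) 0 + τ) :=
      Finset.sum_le_sum fun i _ => by linarith [le_max_left (p i - τ) 0]
    have h2 : ∑ i ∈ s, max (p i - τ) 0 ≤ ∑ i, max (p i - τ) 0 :=
      Finset.sum_le_sum_of_subset_of_nonneg (Finset.subset_univ s) fun i _ _ => le_max_right _ _
    have h3 : ∑ i, max (p i - τ) 0 = ∑ i : Fin N, if i.val < k then p i - τ else 0 := by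
      refine Finset.sum_congr rfl fun i _ => ?_
      split_ifs with h
      · exact max_eq_left (sub_nonneg.2 (ha (Fin.le_def.2 h.le)))
      · exact max_eq_right (sub_nonpos.2 (ha (Fin.le_def.2 (not_lt.1 h))))
    have h4 : ∑ i : Fin N, (if i.val < k then p i - τ else 0)
        = (∑ i : Fin N, if i.val < k then p i else 0) - k * τ := by
      have : ∀ i : Fin N, (if i.val < k then p i - τ else 0)
          = (if i.val < k then p i else 0) - if i.val < k then τ else 0 := fun i => by
        split_ifs <;> simp
      have hc : (Finset.univ.filter fun i : Fin N => i.val < k).card = k := by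
        rw [Fin.card_filter_val_lt]; omega
      rw [Finset.sum_congr rfl fun i _ => this i, Finset.sum_sub_distrib, ← Finset.sum_filter
        (fun i : Fin N => i.val < k) (fun _ => τ), Finset.sum_const, hc, nsmul_eq_mul]
    have h5 : (s.card : ℝ) * τ ≤ k * τ :=
      mul_le_mul_of_nonneg_right (by exact_mod_cast hs) (hp _)
    rw [Finset.sum_add_distrib, Finset.sum_const, nsmul_eq_mul] at h1
    linarith
  · have : ∀ i : Fin N, (if i.val < k then p i else 0) = p i := fun i => if_pos (by omega)
    rw [Finset.sum_congr rfl fun i _ => this i]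
    exact Finset.sum_le_sum_of_subset_of_nonneg (Finset.subset_univ s) fun i _ _ => hp i

lemma mul_sum_le_sum_mul_of_prefix_nonneg : ∀ {N : ℕ} {c x : Fin (N + 1) → ℝ}, Antitone c →
    (∀ k : ℕ, 0 ≤ ∑ i, if i.val < k then x i else 0) →
    c (Fin.last N) * ∑ i, x i ≤ ∑ i, c i * x i
  | 0, c, x, _, _ => by simp
  | N + 1, c, x, hc, hx => by
    have hp : ∀ k : ℕ, 0 ≤ ∑ i : Fin (N + 1), if i.val < k then x i.castSucc else 0 := by
      intro k
      have := hx (min k (N + 1))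
      rw [Fin.sum_univ_castSucc] at this
      simp only [Fin.val_castSucc, Fin.val_last, lt_min_iff, lt_irrefl, and_false, if_false,
        add_zero, Fin.is_lt, and_true] at this
      exact this
    have ih := mul_sum_le_sum_mul_of_prefix_nonneg (c := fun i => c i.castSucc)
      (x := fun i => x i.castSucc) (fun i j h => hc (Fin.castSucc_le_castSucc_iff.2 h)) hp
    have htot : 0 ≤ ∑ i : Fin (N + 1), x i.castSucc := by
      simpa [Fin.is_le] using hp (N + 1)
    have hl : c (Fin.last (N + 1)) ≤ c (Fin.last N).castSucc := hc (Fin.le_last _)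
    rw [Fin.sum_univ_castSucc, Fin.sum_univ_castSucc (fun i => c i * x i)]
    nlinarith [mul_le_mul_of_nonneg_right hl htot]

lemma exists_equiv_antitone (c : ι → ℝ) :
    ∃ e : Fin (Fintype.card ι) ≃ ι, Antitone (c ∘ e) := by
  let e₀ := (Fintype.equivFin ι).symm
  refine ⟨(Tuple.sort (fun i => -c (e₀ i))).trans e₀, fun i j h => ?_⟩
  have := Tuple.monotone_sort (fun i => -c (e₀ i)) h
  simpa using this

lemma Majorises.exists_perm_sum_mul_le {P Q : ι → ℝ} (hP : IsProbVec P) (hQ : IsProbVec Q)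
    (h : Majorises P Q) (c : ι → ℝ) :
    ∃ σ : Equiv.Perm ι, ∑ i, c i * Q i ≤ ∑ i, c i * P (σ i) := by
  obtain ⟨e, he⟩ := exists_equiv_antitone c
  obtain ⟨e', he'⟩ := exists_equiv_antitone P
  refine ⟨e.symm.trans e', ?_⟩
  have key : 0 ≤ ∑ k, c (e k) * (P (e' k) - Q (e k)) := by
    have hpre : ∀ k : ℕ, 0 ≤ ∑ i : Fin (Fintype.card ι),
        if i.val < k then P (e' i) - Q (e i) else 0 := by
      intro k
      have h1 := kMaxSum_le_sum_antitone (p := P ∘ e') (fun i => hP.1 _) he' k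
      have h2 := sum_le_kMaxSum (Q ∘ e) (k := k) (s := Finset.univ.filter fun i => i.val < k) (by
        rw [Fin.card_filter_val_lt]; omega)
      rw [kMaxSum_comp_equiv] at h1 h2
      rw [Finset.sum_filter] at h2
      have h3 : ∀ i : Fin (Fintype.card ι), (if i.val < k then P (e' i) - Q (e i) else 0)
          = (if i.val < k then P (e' i) else 0) - if i.val < k then Q (e i) else 0 := fun i => by
        split_ifs <;> simp
      rw [Finset.sum_congr rfl fun i _ => h3 i, Finset.sum_sub_distrib]
      exact sub_nonneg.2 ((h2.trans (h k)).trans h1)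
    have htot : ∑ i, (P (e' i) - Q (e i)) = 0 := by
      rw [Finset.sum_sub_distrib, e'.sum_comp, e.sum_comp, hP.2, hQ.2, sub_self]
    obtain hN | ⟨N, hN⟩ : Fintype.card ι = 0 ∨ ∃ N, Fintype.card ι = N + 1 :=
      (Nat.eq_zero_or_eq_succ_pred _).imp_right fun h => ⟨_, h⟩
    · have : IsEmpty (Fin (Fintype.card ι)) := by rw [hN]; infer_instance
      simp
    · have gen : ∀ M, M = N + 1 → ∀ c x : Fin M → ℝ, Antitone c →
          (∀ k : ℕ, 0 ≤ ∑ i, if i.val < k then x i else 0) → ∑ i, x i = 0 →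
          0 ≤ ∑ i, c i * x i := by
        rintro M rfl c x hc hx h0
        simpa [h0] using mul_sum_le_sum_mul_of_prefix_nonneg hc hx
      exact gen _ hN _ _ he hpre htot
  simp only [mul_sub, Finset.sum_sub_distrib] at key
  rw [e.sum_comp (fun i => c i * Q i)] at key
  rw [← e.sum_comp (fun i => c i * P _)]
  simpa using key

lemma Majorises.mem_convexHull {P Q : ι → ℝ} (hP : IsProbVec P) (hQ : IsProbVec Q)
    (h : Majorises P Q) :
    Q ∈ convexHull ℝ (Set.range fun σ : Equiv.Perm ι => P ∘ σ) := by
  classical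
  by_contra hn
  obtain ⟨f, u, hf, hu⟩ := geometric_hahn_banach_closed_point (convex_convexHull ℝ _)
    ((Set.finite_range fun σ : Equiv.Perm ι => P ∘ σ).isClosed_convexHull ℝ) hn
  have hrep : ∀ x : ι → ℝ, f x = ∑ i, f (Pi.single i 1) * x i := fun x => by
    conv_lhs => rw [pi_eq_sum_univ' x, map_sum]
    refine Finset.sum_congr rfl fun i _ => ?_
    rw [map_smul, smul_eq_mul, mul_comm]
  obtain ⟨σ, hσ⟩ := h.exists_perm_sum_mul_le hP hQ fun i => f (Pi.single i 1)
  have h1 := hf (P ∘ σ) (subset_convexHull ℝ _ ⟨σ, rfl⟩)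
  rw [hrep] at h1 hu
  simp only [Function.comp_apply] at h1
  linarith

end Majorisation

section Transfer

variable {ι κ : Type*} [Fintype ι] [Fintype κ]

lemma add_sqrt_mul_le_sqrt_mul_add {x y z w : ℝ} (hx : 0 ≤ x) (hy : 0 ≤ y) (hz : 0 ≤ z)
    (hw : 0 ≤ w) :
    Real.sqrt (x * y) + Real.sqrt (z * w) ≤ Real.sqrt ((x + z) * (y + w)) := by
  refine Real.le_sqrt_of_sq_le ?_
  rw [Real.sqrt_mul hx, Real.sqrt_mul hz]
  nlinarith [sq_nonneg (√x * √w - √y * √z), Real.sq_sqrt hx, Real.sq_sqrt hy, Real.sq_sqrt hz,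
    Real.sq_sqrt hw, mul_nonneg hx hw]

/-- Pre-majorisation can be turned into post-majorisation without loss of fidelity. -/
lemma exists_majorised_of_premajorised {P P' : ι → ℝ} {Q : κ → ℝ} (hP : IsProbVec P)
    (hP' : IsProbVec P') (hQ : IsProbVec Q) (e : κ ≃ ι) (h : Majorises P' Q) :
    ∃ Qt : κ → ℝ, IsProbVec Qt ∧ Majorises P Qt ∧
      ∑ i, Real.sqrt (P' i * P i) ≤ ∑ i, Real.sqrt (Q i * Qt i) := by
  let C : Set (ι → ℝ) := {x | (∀ i, 0 ≤ x i) ∧ ∃ y : ι → ℝ, IsProbVec y ∧ Majorises P y ∧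
      ∑ i, Real.sqrt (P' i * P i) ≤ ∑ i, Real.sqrt (x i * y i)}
  have hC : Convex ℝ C := by
    rintro x ⟨hx, x', hx', hmx, hfx⟩ y ⟨hy, y', hy', hmy, hfy⟩ a b ha hb hab
    refine ⟨fun i => add_nonneg (mul_nonneg ha (hx i)) (mul_nonneg hb (hy i)), a • x' + b • y',
      ⟨fun i => add_nonneg (mul_nonneg ha (hx'.1 i)) (mul_nonneg hb (hy'.1 i)), ?_⟩, ?_, ?_⟩
    · simp [Finset.sum_add_distrib, ← Finset.mul_sum, hx'.2, hy'.2, hab]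
    · refine fun k => kMaxSum_le fun s hs => ?_
      have h1 := (sum_le_kMaxSum x' hs).trans (hmx k)
      have h2 := (sum_le_kMaxSum y' hs).trans (hmy k)
      simp only [Pi.add_apply, Pi.smul_apply, smul_eq_mul, Finset.sum_add_distrib,
        ← Finset.mul_sum]
      calc _ ≤ a * kMaxSum P k + b * kMaxSum P k := by gcongr
        _ = kMaxSum P k := by rw [← add_mul, hab, one_mul]
    · calc ∑ i, Real.sqrt (P' i * P i)
          = a * ∑ i, Real.sqrt (P' i * P i) + b * ∑ i, Real.sqrt (P' i * P i) := by
            rw [← add_mul, hab, one_mul]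
        _ ≤ a * ∑ i, Real.sqrt (x i * x' i) + b * ∑ i, Real.sqrt (y i * y' i) := by gcongr
        _ = ∑ i, (Real.sqrt ((a * x i) * (a * x' i)) + Real.sqrt ((b * y i) * (b * y' i))) := by
            rw [Finset.sum_add_distrib, Finset.mul_sum, Finset.mul_sum]
            congr 1 <;> refine Finset.sum_congr rfl fun i _ => ?_
            · rw [show a * x i * (a * x' i) = a ^ 2 * (x i * x' i) by ring,
                Real.sqrt_mul (sq_nonneg a), Real.sqrt_sq ha]
            · rw [show b * y i * (b * y' i) = b ^ 2 * (y i * y' i) by ring,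
                Real.sqrt_mul (sq_nonneg b), Real.sqrt_sq hb]
        _ ≤ _ := Finset.sum_le_sum fun i _ => add_sqrt_mul_le_sqrt_mul_add
            (mul_nonneg ha (hx i)) (mul_nonneg ha (hx'.1 i)) (mul_nonneg hb (hy i))
            (mul_nonneg hb (hy'.1 i))
  have hQe : IsProbVec (Q ∘ e.symm) :=
    ⟨fun i => hQ.1 _, by simpa using (e.symm.sum_comp Q).trans hQ.2⟩
  have hm : Majorises P' (Q ∘ e.symm) := fun k => by rw [kMaxSum_comp_equiv]; exact h k
  have hsub : (Set.range fun σ : Equiv.Perm ι => P' ∘ σ) ⊆ C := by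
    rintro _ ⟨σ, rfl⟩
    refine ⟨fun i => hP'.1 _, P ∘ σ, ⟨fun i => hP.1 _, (Equiv.sum_comp σ P).trans hP.2⟩,
      fun k => (kMaxSum_comp_equiv P σ k).le, ?_⟩
    exact (Equiv.sum_comp σ fun i => Real.sqrt (P' i * P i)).ge
  obtain ⟨-, y, hy, hmy, hfy⟩ := convexHull_min hsub hC (hm.mem_convexHull hP' hQe)
  refine ⟨y ∘ e, ⟨fun i => hy.1 _, (e.sum_comp y).trans hy.2⟩,
    fun k => by rw [kMaxSum_comp_equiv]; exact hmy k, hfy.trans_eq ?_⟩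
  rw [← e.sum_comp]
  simp

end Transfer

section UpperMass

variable {ι κ : Type*} [Fintype ι] [Fintype κ]

/-- The indices of the entries of `p` which are at least `exp (-t)`. -/
def upSet (p : ι → ℝ) (t : ℝ) : Finset ι := Finset.univ.filter fun i => Real.exp (-t) ≤ p i

/-- The total mass of the entries of `p` which are at least `exp (-t)`. -/
def upMass (p : ι → ℝ) (t : ℝ) : ℝ := ∑ i ∈ upSet p t, p i

lemma upSet_mono (p : ι → ℝ) : Monotone (upSet p) := fun s t h i hi => by
  simp only [upSet, Finset.mem_filter, Finset.mem_univ, true_and] at hi ⊢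
  exact (Real.exp_le_exp.2 (neg_le_neg h)).trans hi

lemma card_upSet_le {p : ι → ℝ} (hp : IsProbVec p) (t : ℝ) :
    (upSet p t).card ≤ ⌊Real.exp t⌋₊ := by
  refine Nat.le_floor ?_
  have h1 : (upSet p t).card * Real.exp (-t) ≤ ∑ i ∈ upSet p t, p i := by
    rw [← nsmul_eq_mul]
    exact Finset.card_nsmul_le_sum _ _ _ fun i hi => (Finset.mem_filter.1 hi).2
  have h2 : ∑ i ∈ upSet p t, p i ≤ 1 :=
    (sum_le_kMaxSum p le_rfl).trans (kMaxSum_le_one hp _)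
  calc ((upSet p t).card : ℝ) = (upSet p t).card * Real.exp (-t) * Real.exp t := by
        rw [mul_assoc, ← Real.exp_add]; simp
    _ ≤ 1 * Real.exp t := by gcongr; exact h1.trans h2
    _ = _ := one_mul _

lemma upMass_le_kMaxSum {p : ι → ℝ} (hp : IsProbVec p) (t : ℝ) :
    upMass p t ≤ kMaxSum p ⌊Real.exp t⌋₊ :=
  sum_le_kMaxSum p (card_upSet_le hp t)

lemma kMaxSum_floor_le {p : ι → ℝ} (hp : IsProbVec p) (s t : ℝ) :
    kMaxSum p ⌊Real.exp s⌋₊ ≤ upMass p t + Real.exp (s - t) := by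
  classical
  refine kMaxSum_le fun S hS => ?_
  have h1 : ∑ i ∈ S, p i ≤ ∑ i ∈ S, ((if i ∈ upSet p t then p i else 0) + Real.exp (-t)) := by
    refine Finset.sum_le_sum fun i _ => ?_
    split_ifs with h
    · linarith [Real.exp_pos (-t)]
    · simp only [upSet, Finset.mem_filter, Finset.mem_univ, true_and, not_le] at h
      linarith
  have h2 : ∑ i ∈ S, (if i ∈ upSet p t then p i else 0) ≤ upMass p t := by
    refine (Finset.sum_le_sum_of_subset_of_nonneg (Finset.subset_univ S) fun i _ _ => ?_).trans ?_
    · split_ifs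
      exacts [hp.1 i, le_rfl]
    · rw [← Finset.sum_filter]
      refine le_of_eq (Finset.sum_congr (by ext; simp) fun _ _ => rfl)
  have h3 : (S.card : ℝ) * Real.exp (-t) ≤ Real.exp (s - t) := by
    rw [sub_eq_add_neg, Real.exp_add]
    gcongr
    exact (Nat.cast_le.2 hS).trans (Nat.floor_le (Real.exp_pos _).le)
  rw [Finset.sum_add_distrib, Finset.sum_const, nsmul_eq_mul] at h1
  linarith

/-- Summation by parts for the step function with values `v 0, …, v K`. -/
def stepSum (v : ℕ → ℝ) (K : ℕ) (x : ℕ → ℝ) : ℝ :=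
  v K + ∑ j ∈ Finset.range K, (v j - v (j + 1)) * x j

lemma exists_stepSum_indicator_eq (K : ℕ) (p : ℕ → Prop) [DecidablePred p]
    (hp : ∀ j, p j → p (j + 1)) :
    ∃ l ≤ K, (∀ j < l, ¬ p j) ∧ (l < K → p l) ∧
      ∀ v : ℕ → ℝ, stepSum v K (fun j => if p j then 1 else 0) = v l := by
  induction K with
  | zero => exact ⟨0, le_rfl, by simp, by simp, by simp [stepSum]⟩
  | succ K ih =>
    by_cases hK : p K
    · obtain ⟨l, hl, h1, h2, h3⟩ := ih
      refine ⟨l, hl.trans K.le_succ, h1, fun _ => ?_, fun v => ?_⟩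
      · rcases hl.lt_or_eq with h | rfl
        exacts [h2 h, hK]
      · rw [← h3 v, stepSum, stepSum, Finset.sum_range_succ, if_pos hK]
        ring
    · have hn : ∀ j < K + 1, ¬ p j := fun j hj hpj => hK
        (Nat.le_induction hpj (fun m _ hm => hp m hm) K (Nat.lt_succ_iff.1 hj))
      refine ⟨K + 1, le_rfl, hn, by simp, fun v => ?_⟩
      rw [stepSum, Finset.sum_eq_zero fun j hj => by
        rw [if_neg (hn j (Finset.mem_range.1 hj)), mul_zero], add_zero]

lemma sum_mul_stepSum {w : ι → ℝ} (hw : ∑ i, w i = 1) (v : ℕ → ℝ) (K : ℕ) (x : ι → ℕ → ℝ) :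
    ∑ i, w i * stepSum v K (x i) = stepSum v K fun j => ∑ i, w i * x i j := by
  simp only [stepSum, mul_add, Finset.sum_add_distrib, ← Finset.sum_mul, hw, one_mul,
    Finset.mul_sum]
  rw [Finset.sum_comm]
  congr 1
  refine Finset.sum_congr rfl fun j _ => Finset.sum_congr rfl fun i _ => by ring

lemma stepSum_le_stepSum {v : ℕ → ℝ} (hv : Antitone v) (K : ℕ) {x y : ℕ → ℝ} (h : ∀ j, x j ≤ y j) :
    stepSum v K x ≤ stepSum v K y := by
  unfold stepSum
  gcongr with j
  · exact sub_nonneg.2 (hv j.le_succ)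
  · exact h j

lemma sum_sqrt_mul_le_stepSum {P : ι → ℝ} {Q Qt : κ → ℝ} (hQ : IsProbVec Q) (hQt : IsProbVec Qt)
    (hm : Majorises P Qt) {t : ℕ → ℝ} (ht : Monotone t) {v : ℕ → ℝ} (hv : Antitone v)
    (hv0 : ∀ j, 0 < v j) (K : ℕ) :
    ∑ i, Real.sqrt (Q i * Qt i) ≤ (stepSum v K (fun j => kMaxSum P ⌊Real.exp (t j)⌋₊)
      + stepSum (fun j => (v j)⁻¹) K fun j => upMass Q (t j)) / 2 := by
  classical
  set χ : κ → ℕ → ℝ := fun i j => if i ∈ upSet Q (t j) then 1 else 0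
  have hmass : ∀ (w : κ → ℝ) j, ∑ i, w i * χ i j = ∑ i ∈ upSet Q (t j), w i := fun w j => by
    simp [χ]
  have h1 : ∑ i, Qt i * stepSum v K (χ i) ≤ stepSum v K fun j => kMaxSum P ⌊Real.exp (t j)⌋₊ := by
    rw [sum_mul_stepSum hQt.2]
    refine stepSum_le_stepSum hv K fun j => ?_
    rw [hmass]
    exact (sum_le_kMaxSum Qt (card_upSet_le hQ _)).trans (hm _)
  have h2 : ∑ i, Q i * stepSum (fun j => (v j)⁻¹) K (χ i)
      = stepSum (fun j => (v j)⁻¹) K fun j => upMass Q (t j) := by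
    rw [sum_mul_stepSum hQ.2]
    simp only [hmass, upMass]
  have h3 : ∀ i, Real.sqrt (Q i * Qt i) ≤
      (Qt i * stepSum v K (χ i) + Q i * stepSum (fun j => (v j)⁻¹) K (χ i)) / 2 := by
    intro i
    obtain ⟨l, -, -, -, hl⟩ := exists_stepSum_indicator_eq K (fun j => i ∈ upSet Q (t j))
      fun j hj => upSet_mono Q (ht j.le_succ) hj
    have e1 : stepSum v K (χ i) = v l := hl v
    have e2 : stepSum (fun j => (v j)⁻¹) K (χ i) = (v l)⁻¹ := hl fun j => (v j)⁻¹
    rw [e1, e2]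
    have ha := mul_nonneg (hQt.1 i) (hv0 l).le
    have hb := mul_nonneg (hQ.1 i) (inv_pos.2 (hv0 l)).le
    have : Q i * Qt i = (Qt i * v l) * (Q i * (v l)⁻¹) := by
      have := (hv0 l).ne'
      field_simp
    rw [this, Real.sqrt_mul ha]
    nlinarith [sq_nonneg (√(Qt i * v l) - √(Q i * (v l)⁻¹)), Real.sq_sqrt ha, Real.sq_sqrt hb]
  calc _ ≤ _ := Finset.sum_le_sum fun i _ => h3 i
    _ ≤ _ := by
      rw [← Finset.sum_div, Finset.sum_add_distrib, h2]
      gcongr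

end UpperMass

section Achievability

variable {ι κ : Type*} [Fintype ι] [Fintype κ]

lemma sum_upSet_eq_of_blocks {P f : ι → ℝ} {t v : ℕ → ℝ} (ht : Monotone t)
    (h0 : ∀ i ∈ upSet P (t 0), f i = v 0 * P i) {j : ℕ}
    (h : ∀ l < j, ∀ i, i ∈ upSet P (t (l + 1)) → i ∉ upSet P (t l) → f i = v (l + 1) * P i) :
    ∑ i ∈ upSet P (t j), f i = v 0 * upMass P (t 0)
      + ∑ l ∈ Finset.range j, v (l + 1) * (upMass P (t (l + 1)) - upMass P (t l)) := by
  classical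
  induction j with
  | zero =>
    rw [Finset.sum_congr rfl h0, ← Finset.mul_sum]
    simp [upMass]
  | succ j ih =>
    have hs := upSet_mono P (ht j.le_succ)
    have h1 : ∀ g : ι → ℝ, ∑ i ∈ upSet P (t (j + 1)), g i
        = ∑ i ∈ upSet P (t (j + 1)) \ upSet P (t j), g i + ∑ i ∈ upSet P (t j), g i :=
      fun g => (Finset.sum_sdiff hs).symm
    rw [h1 f, ih fun l hl => h l (hl.trans j.lt_succ_self), Finset.sum_range_succ,
      Finset.sum_congr rfl fun i hi => h j j.lt_succ_self i (Finset.mem_sdiff.1 hi).1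
        (Finset.mem_sdiff.1 hi).2, ← Finset.mul_sum]
    have h2 : upMass P (t (j + 1)) - upMass P (t j)
        = ∑ i ∈ upSet P (t (j + 1)) \ upSet P (t j), P i := by
      rw [upMass, upMass, h1 P]
      ring
    rw [h2]
    ring

/-- Redistribution of the mass of `P` over the blocks cut out by the thresholds `t j`, so that the
cumulative masses are `a j`. -/
lemma exists_redistribution {P : ι → ℝ} (hP : IsProbVec P) {t a : ℕ → ℝ} (ht : Monotone t)
    (ha : Monotone a) (ha0 : 0 ≤ a 0) {K : ℕ} (haK : a K = 1) (hu0 : 0 < upMass P (t 0))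
    (hu : ∀ l < K, upMass P (t l) < upMass P (t (l + 1))) :
    ∃ P' : ι → ℝ, IsProbVec P' ∧ (∀ j ≤ K, ∑ i ∈ upSet P (t j), P' i = a j) ∧
      ∑ l ∈ Finset.range K, Real.sqrt ((a (l + 1) - a l) * (upMass P (t (l + 1)) - upMass P (t l)))
        ≤ ∑ i, Real.sqrt (P' i * P i) := by
  classical
  let v : ℕ → ℝ := fun j => Nat.casesOn j (a 0 / upMass P (t 0))
    fun l => (a (l + 1) - a l) / (upMass P (t (l + 1)) - upMass P (t l))
  have hmono : Monotone fun j => upSet P (t j) := fun i j h => upSet_mono P (ht h)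
  have hum : ∀ l, upMass P (t l) ≤ upMass P (t (l + 1)) := fun l =>
    Finset.sum_le_sum_of_subset_of_nonneg (hmono l.le_succ) fun i _ _ => hP.1 i
  have hv : ∀ j, 0 ≤ v j
    | 0 => div_nonneg ha0 hu0.le
    | l + 1 => div_nonneg (sub_nonneg.2 (ha l.le_succ)) (sub_nonneg.2 (hum l))
  let lev : ι → ℕ := fun i => ((Finset.range K).filter fun j => i ∉ upSet P (t j)).card
  have hlev0 : ∀ i ∈ upSet P (t 0), lev i = 0 := fun i hi =>
    Finset.card_eq_zero.2 (Finset.filter_eq_empty_iff.2 fun j _ => not_not.2 (hmono j.zero_le hi))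
  have hlev : ∀ l < K, ∀ i, i ∈ upSet P (t (l + 1)) → i ∉ upSet P (t l) → lev i = l + 1 := by
    intro l hl i h1 h2
    have : ((Finset.range K).filter fun j => i ∉ upSet P (t j)) = Finset.range (l + 1) := by
      ext j
      simp only [Finset.mem_filter, Finset.mem_range]
      constructor
      · rintro ⟨-, h⟩
        by_contra hj
        exact h (hmono (not_lt.1 hj) h1)
      · exact fun hj => ⟨by omega, fun h => h2 (hmono (Nat.lt_succ_iff.1 hj) h)⟩
    rw [show lev i = _ from congrArg Finset.card this, Finset.card_range]
  let P' : ι → ℝ := fun i => if i ∈ upSet P (t K) then v (lev i) * P i else 0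
  have hP'0 : ∀ i, 0 ≤ P' i := fun i => by
    simp only [P']
    split_ifs
    exacts [mul_nonneg (hv _) (hP.1 i), le_rfl]
  have b0 : ∀ i ∈ upSet P (t 0), P' i = v 0 * P i := fun i hi => by
    simp only [P', if_pos (hmono K.zero_le hi), hlev0 i hi]
  have b1 : ∀ l < K, ∀ i, i ∈ upSet P (t (l + 1)) → i ∉ upSet P (t l) →
      P' i = v (l + 1) * P i := fun l hl i h1 h2 => by
    simp only [P', if_pos (hmono hl h1), hlev l hl i h1 h2]
  have hcum : ∀ j ≤ K, ∑ i ∈ upSet P (t j), P' i = a j := by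
    intro j hj
    rw [sum_upSet_eq_of_blocks ht b0 fun l hl => b1 l (hl.trans_le hj)]
    have e : ∀ l ∈ Finset.range j, v (l + 1) * (upMass P (t (l + 1)) - upMass P (t l))
        = a (l + 1) - a l := fun l hl =>
      div_mul_cancel₀ _ (sub_pos.2 (hu l ((Finset.mem_range.1 hl).trans_le hj))).ne'
    rw [Finset.sum_congr rfl e, Finset.sum_range_sub,
      show v 0 * upMass P (t 0) = a 0 from div_mul_cancel₀ _ hu0.ne']
    ring
  refine ⟨P', ⟨hP'0, ?_⟩, hcum, ?_⟩
  · rw [← haK, ← hcum K le_rfl]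
    exact (Finset.sum_subset (Finset.subset_univ _) fun i _ hi => if_neg hi).symm
  · have sq : ∀ l i, P' i = v l * P i → Real.sqrt (P' i * P i) = Real.sqrt (v l) * P i :=
      fun l i h => by
        rw [h, mul_assoc, Real.sqrt_mul (hv l), Real.sqrt_mul_self (hP.1 i)]
    have := sum_upSet_eq_of_blocks (f := fun i => Real.sqrt (P' i * P i))
      (v := fun l => Real.sqrt (v l)) (j := K) ht (fun i hi => sq 0 i (b0 i hi))
      (fun l hl i h1 h2 => sq (l + 1) i (b1 l hl i h1 h2))
    calc _ = ∑ l ∈ Finset.range K,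
          Real.sqrt (v (l + 1)) * (upMass P (t (l + 1)) - upMass P (t l)) := by
          refine Finset.sum_congr rfl fun l hl => ?_
          have hp := sub_pos.2 (hu l (Finset.mem_range.1 hl))
          have e : (a (l + 1) - a l) * (upMass P (t (l + 1)) - upMass P (t l))
              = v (l + 1) * ((upMass P (t (l + 1)) - upMass P (t l)) *
                (upMass P (t (l + 1)) - upMass P (t l))) := by
            rw [← mul_assoc]
            congr 1
            exact (div_mul_cancel₀ _ hp.ne').symm
          rw [e, Real.sqrt_mul (hv (l + 1)), Real.sqrt_mul_self hp.le]
      _ ≤ ∑ i ∈ upSet P (t K), Real.sqrt (P' i * P i) := by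
          rw [this]
          exact le_add_of_nonneg_left (mul_nonneg (Real.sqrt_nonneg _) hu0.le)
      _ ≤ _ := Finset.sum_le_sum_of_subset_of_nonneg (Finset.subset_univ _)
          fun i _ _ => Real.sqrt_nonneg _

lemma exists_majorised_of_thresholds {P : ι → ℝ} {Q : κ → ℝ} (hP : IsProbVec P)
    (hQ : IsProbVec Q) (e : κ ≃ ι) {t a : ℕ → ℝ} (ht : Monotone t)
    (ha : Monotone a) (ha0 : 0 ≤ a 0) {K : ℕ} (haK : a K = 1) (hu0 : 0 < upMass P (t 0))
    (hu : ∀ l < K, upMass P (t l) < upMass P (t (l + 1))) {δ : ℝ} (hδ0 : 0 ≤ δ) (hδ1 : δ ≤ 1)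
    (hQ0 : kMaxSum Q ⌊Real.exp (t 0)⌋₊ ≤ δ)
    (hQ1 : ∀ l < K, kMaxSum Q ⌊Real.exp (t (l + 1))⌋₊ ≤ δ + (1 - δ) * a l) :
    ∃ Qt : κ → ℝ, IsProbVec Qt ∧ Majorises P Qt ∧ Real.sqrt (1 - δ) * ∑ l ∈ Finset.range K,
      Real.sqrt ((a (l + 1) - a l) * (upMass P (t (l + 1)) - upMass P (t l)))
        ≤ ∑ i, Real.sqrt (Q i * Qt i) := by
  classical
  obtain ⟨P', hP', hcum, hfid⟩ := exists_redistribution hP ht ha ha0 haK hu0 hu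
  have hδ : 0 ≤ 1 - δ := sub_nonneg.2 hδ1
  have hne : (upSet P (t 0)).Nonempty := by
    by_contra h
    rw [upMass, Finset.not_nonempty_iff_eq_empty.1 h] at hu0
    simp at hu0
  obtain ⟨top, htop⟩ := hne
  let R : ι → ℝ := fun i => (1 - δ) * P' i + if i = top then δ else 0
  have hR : IsProbVec R := by
    refine ⟨fun i => add_nonneg (mul_nonneg hδ (hP'.1 i)) (by split_ifs <;> simp [hδ0]), ?_⟩
    simp [R, Finset.sum_add_distrib, ← Finset.mul_sum, hP'.2]
  have htop' : ∀ j, top ∈ upSet P (t j) := fun j => upSet_mono P (ht j.zero_le) htop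
  have hRcum : ∀ j ≤ K, δ + (1 - δ) * a j ≤ kMaxSum R ⌊Real.exp (t j)⌋₊ := by
    intro j hj
    refine le_trans (le_of_eq ?_) (sum_le_kMaxSum R (card_upSet_le hP (t j)))
    simp only [R, Finset.sum_add_distrib, ← Finset.mul_sum, hcum j hj, Finset.sum_ite_eq',
      if_pos (htop' j)]
    ring
  have hmaj : Majorises R Q := by
    intro k
    rcases Nat.eq_zero_or_pos k with rfl | hk
    · rw [kMaxSum_zero, kMaxSum_zero]
    by_cases hk0 : k < ⌊Real.exp (t 0)⌋₊
    · calc kMaxSum Q k ≤ δ := (kMaxSum_mono Q hk0.le).trans hQ0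
        _ ≤ ∑ i ∈ {top}, R i := by
          simp only [R, Finset.sum_singleton, if_true]
          exact le_add_of_nonneg_left (mul_nonneg hδ (hP'.1 _))
        _ ≤ _ := sum_le_kMaxSum R (by rw [Finset.card_singleton]; exact hk)
    · have : ∀ j ≤ K, k < ⌊Real.exp (t j)⌋₊ → kMaxSum Q k ≤ kMaxSum R k := by
        intro j
        induction j with
        | zero => exact fun _ h => absurd h hk0
        | succ j ih =>
          intro hj h
          by_cases hkj : k < ⌊Real.exp (t j)⌋₊
          · exact ih (by omega) hkj
          · exact ((kMaxSum_mono Q h.le).trans (hQ1 j (by omega))).trans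
              ((hRcum j (by omega)).trans (kMaxSum_mono R (not_lt.1 hkj)))
      by_cases hkK : k < ⌊Real.exp (t K)⌋₊
      · exact this K le_rfl hkK
      · refine (kMaxSum_le_one hQ k).trans (le_trans ?_ ((hRcum K le_rfl).trans
          (kMaxSum_mono R (not_lt.1 hkK))))
        rw [haK]
        linarith
  obtain ⟨Qt, h1, h2, h3⟩ := exists_majorised_of_premajorised hP hR hQ e hmaj
  refine ⟨Qt, h1, h2, le_trans ?_ h3⟩
  calc _ ≤ Real.sqrt (1 - δ) * ∑ i, Real.sqrt (P' i * P i) := by gcongr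
    _ = ∑ i, Real.sqrt ((1 - δ) * (P' i * P i)) := by
      rw [Finset.mul_sum]
      exact Finset.sum_congr rfl fun i _ => (Real.sqrt_mul hδ _).symm
    _ ≤ _ := Finset.sum_le_sum fun i _ => Real.sqrt_le_sqrt (by
      rw [← mul_assoc]
      refine mul_le_mul_of_nonneg_right (le_add_of_nonneg_right ?_) (hP.1 i)
      split_ifs <;> simp [hδ0])

end Achievability

section Gaussian

open MeasureTheory Topology

lemma normPDF_eq_gaussianPDFReal (μ : ℝ) {v : ℝ} (hv : 0 < v) :
    normPDF μ v = ProbabilityTheory.gaussianPDFReal μ ⟨v, hv.le⟩ := by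
  funext x
  exact div_eq_inv_mul _ _

lemma normPDF_pos (μ : ℝ) {v : ℝ} (hv : 0 < v) (x : ℝ) : 0 < normPDF μ v x := by
  unfold normPDF
  positivity

lemma continuous_normPDF (μ v : ℝ) : Continuous (normPDF μ v) := by
  unfold normPDF
  fun_prop

lemma integrable_normPDF (μ : ℝ) {v : ℝ} (hv : 0 < v) : Integrable (normPDF μ v) := by
  rw [normPDF_eq_gaussianPDFReal μ hv]
  exact ProbabilityTheory.integrable_gaussianPDFReal _ _

lemma integral_normPDF (μ : ℝ) {v : ℝ} (hv : 0 < v) : ∫ x, normPDF μ v x = 1 := by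
  rw [normPDF_eq_gaussianPDFReal μ hv]
  exact ProbabilityTheory.integral_gaussianPDFReal_eq_one _ (fun h => hv.ne' (congrArg NNReal.toReal h))

lemma normCDF_sub (μ : ℝ) {v : ℝ} (hv : 0 < v) (x y : ℝ) :
    normCDF μ v y - normCDF μ v x = ∫ t in x..y, normPDF μ v t :=
  intervalIntegral.integral_Iic_sub_Iic (integrable_normPDF μ hv).integrableOn
    (integrable_normPDF μ hv).integrableOn

lemma hasDerivAt_normCDF (μ : ℝ) {v : ℝ} (hv : 0 < v) (x : ℝ) :
    HasDerivAt (normCDF μ v) (normPDF μ v x) x := by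
  have h : normCDF μ v = fun y => normCDF μ v 0 + ∫ t in (0 : ℝ)..y, normPDF μ v t := by
    funext y
    rw [← normCDF_sub μ hv]
    ring
  rw [h]
  exact (intervalIntegral.integral_hasDerivAt_right
    ((continuous_normPDF μ v).intervalIntegrable _ _)
    (continuous_normPDF μ v).stronglyMeasurable.stronglyMeasurableAtFilter
    (continuous_normPDF μ v).continuousAt).const_add _

lemma continuous_normCDF (μ : ℝ) {v : ℝ} (hv : 0 < v) : Continuous (normCDF μ v) :=
  continuous_iff_continuousAt.2 fun x => (hasDerivAt_normCDF μ hv x).continuousAt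

lemma strictMono_normCDF (μ : ℝ) {v : ℝ} (hv : 0 < v) : StrictMono (normCDF μ v) :=
  strictMono_of_deriv_pos fun x => by
    rw [(hasDerivAt_normCDF μ hv x).deriv]
    exact normPDF_pos μ hv x

lemma tendsto_normCDF_atTop (μ : ℝ) {v : ℝ} (hv : 0 < v) :
    Tendsto (normCDF μ v) atTop (𝓝 1) := by
  have := (aecover_Iic (μ := volume) tendsto_id).integral_tendsto_of_countably_generated
    (integrable_normPDF μ hv)
  rwa [integral_normPDF μ hv] at this

lemma tendsto_normCDF_atBot (μ : ℝ) {v : ℝ} (hv : 0 < v) :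
    Tendsto (normCDF μ v) atBot (𝓝 0) := by
  have h := (aecover_Ioi (μ := volume) tendsto_id).integral_tendsto_of_countably_generated
    (integrable_normPDF μ hv)
  rw [integral_normPDF μ hv] at h
  have h2 : normCDF μ v = fun y => 1 - ∫ t in Set.Ioi y, normPDF μ v t := by
    funext y
    rw [← integral_normPDF μ hv, ← intervalIntegral.integral_Iic_add_Ioi
      (integrable_normPDF μ hv).integrableOn (integrable_normPDF μ hv).integrableOn (b := y)]
    simp [normCDF]
  rw [h2]
  simpa using (tendsto_const_nhds (x := (1 : ℝ))).sub h

lemma normCDF_pos (μ : ℝ) {v : ℝ} (hv : 0 < v) (x : ℝ) : 0 < normCDF μ v x := by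
  refine lt_of_le_of_lt ?_ (strictMono_normCDF μ hv (sub_one_lt x))
  exact (strictMono_normCDF μ hv).monotone.le_of_tendsto (tendsto_normCDF_atBot μ hv) _

lemma normCDF_lt_one (μ : ℝ) {v : ℝ} (hv : 0 < v) (x : ℝ) : normCDF μ v x < 1 := by
  refine lt_of_lt_of_le (strictMono_normCDF μ hv (lt_add_one x)) ?_
  exact (strictMono_normCDF μ hv).monotone.ge_of_tendsto (tendsto_normCDF_atTop μ hv) _

lemma normPDF_zero_one_le_one (x : ℝ) : normPDF 0 1 x ≤ 1 := by
  unfold normPDF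
  refine div_le_one_of_le₀ ?_ (Real.sqrt_nonneg _)
  have h1 : (1 : ℝ) ≤ Real.sqrt (2 * Real.pi * 1) :=
    Real.one_le_sqrt.2 (by nlinarith [Real.pi_gt_three])
  refine le_trans (Real.exp_le_one_iff.2 ?_) h1
  nlinarith [sq_nonneg (x - 0)]

lemma Phi_sub_le {x y : ℝ} (h : x ≤ y) : Phi y - Phi x ≤ y - x := by
  have := intervalIntegral.integral_mono_on h (f := normPDF 0 1) (g := fun _ => (1 : ℝ))
    (μ := volume) ((continuous_normPDF 0 1).intervalIntegrable _ _)
    intervalIntegrable_const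
    (fun t _ => normPDF_zero_one_le_one t)
  rw [← normCDF_sub 0 one_pos] at this
  simpa [Phi] using this

lemma integral_sqrt_mul_le {α : Type*} [MeasurableSpace α] {m : Measure α} {f g : α → ℝ}
    (hf : Integrable f m) (hg : Integrable g m) (hf0 : 0 ≤ᵐ[m] f) (hg0 : 0 ≤ᵐ[m] g) :
    ∫ x, Real.sqrt (f x * g x) ∂m ≤ Real.sqrt ((∫ x, f x ∂m) * ∫ x, g x ∂m) := by
  have key : ∀ {f : α → ℝ}, Integrable f m → 0 ≤ᵐ[m] f →
      MemLp (fun x => Real.sqrt (f x)) (ENNReal.ofReal 2) m ∧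
        ∫ x, Real.sqrt (f x) ^ (2 : ℝ) ∂m = ∫ x, f x ∂m := fun {f} hf h0 => by
    have e : (fun x => Real.sqrt (f x) ^ 2) =ᵐ[m] f := h0.mono fun x hx => Real.sq_sqrt hx
    constructor
    · rw [ENNReal.ofReal_ofNat]
      exact (memLp_two_iff_integrable_sq
        (Real.continuous_sqrt.comp_aestronglyMeasurable hf.1)).2 (hf.congr e.symm)
    · simp_rw [Real.rpow_two]
      exact integral_congr_ae e
  have h := integral_mul_le_Lp_mul_Lq_of_nonneg (μ := m) Real.HolderConjugate.two_two
    (ae_of_all _ fun x => Real.sqrt_nonneg (f x)) (ae_of_all _ fun x => Real.sqrt_nonneg (g x))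
    (key hf hf0).1 (key hg hg0).1
  rw [(key hf hf0).2, (key hg hg0).2, ← Real.sqrt_eq_rpow, ← Real.sqrt_eq_rpow,
    ← Real.sqrt_mul (integral_nonneg_of_ae hf0)] at h
  refine le_of_eq_of_le (integral_congr_ae ?_) h
  filter_upwards [hf0] with x hx
  exact Real.sqrt_mul hx _

end Gaussian

section SequenceLimits

open MeasureTheory Topology

variable {ι κ : ℕ → Type*} [∀ n, Fintype (ι n)] [∀ n, Fintype (κ n)]

lemma tendsto_kMaxSum_floor {P : ∀ n, ι n → ℝ} (hP : ∀ n, IsProbVec (P n)) {T : ℕ → ℝ → ℝ}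
    (hT : ∀ y z, y < z → Tendsto (fun n => T n z - T n y) atTop atTop) {G : ℝ → ℝ}
    (hG : Continuous G) (hlim : ∀ y, Tendsto (fun n => upMass (P n) (T n y)) atTop (𝓝 (G y)))
    (y : ℝ) :
    Tendsto (fun n => kMaxSum (P n) ⌊Real.exp (T n y)⌋₊) atTop (𝓝 (G y)) := by
  rw [tendsto_order]
  constructor
  · intro a ha
    filter_upwards [(tendsto_order.1 (hlim y)).1 a ha] with n hn
    exact hn.trans_le (upMass_le_kMaxSum (hP n) _)
  · intro b hb
    obtain ⟨z, hz, hyz⟩ : ∃ z, G z < b ∧ y < z :=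
      (((hG.tendsto y).mono_left nhdsWithin_le_nhds).eventually (eventually_lt_nhds hb)
        |>.and (eventually_mem_nhdsWithin (s := Set.Ioi y))).exists
    have h0 : Tendsto (fun n => Real.exp (T n y - T n z)) atTop (𝓝 0) := by
      refine Real.tendsto_exp_atBot.comp ?_
      refine (tendsto_neg_atTop_atBot.comp (hT y z hyz)).congr fun n => ?_
      simp
    have h1 := (hlim z).add h0
    rw [add_zero] at h1
    filter_upwards [(tendsto_order.1 h1).2 b hz] with n hn
    exact (kMaxSum_floor_le (hP n) _ _).trans_lt hn

lemma tendsto_stepSum (v : ℕ → ℝ) (K : ℕ) {x : ℕ → ℕ → ℝ} {y : ℕ → ℝ}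
    (h : ∀ j, Tendsto (fun n => x n j) atTop (𝓝 (y j))) :
    Tendsto (fun n => stepSum v K (x n)) atTop (𝓝 (stepSum v K y)) :=
  (tendsto_finsetSum _ fun j _ => (h j).const_mul _).const_add _

variable {P : ∀ n, ι n → ℝ} {Q : ∀ n, κ n → ℝ} {T : ℕ → ℝ → ℝ} {μ ν : ℝ}

lemma eventually_fidelity_le (hP : ∀ n, IsProbVec (P n)) (hQ : ∀ n, IsProbVec (Q n))
    (hTm : ∀ n, Monotone (T n))
    (hT : ∀ y z, y < z → Tendsto (fun n => T n z - T n y) atTop atTop) {F G : ℝ → ℝ}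
    (hG : Continuous G) (hlimP : ∀ y, Tendsto (fun n => upMass (P n) (T n y)) atTop (𝓝 (G y)))
    (hlimQ : ∀ y, Tendsto (fun n => upMass (Q n) (T n y)) atTop (𝓝 (F y)))
    {t v : ℕ → ℝ} (ht : Monotone t) (hv : Antitone v) (hv0 : ∀ j, 0 < v j) (K : ℕ) {c : ℝ}
    (hc : (stepSum v K (fun j => G (t j)) + stepSum (fun j => (v j)⁻¹) K fun j => F (t j)) / 2
      < c) :
    ∀ᶠ n in atTop, ∀ Qt : κ n → ℝ, IsProbVec Qt → Majorises (P n) Qt →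
      ∑ i, Real.sqrt (Q n i * Qt i) ≤ c := by
  have h := ((tendsto_stepSum v K fun j => tendsto_kMaxSum_floor hP hT hG hlimP (t j)).add
    (tendsto_stepSum (fun j => (v j)⁻¹) K fun j => hlimQ (t j))).div_const 2
  filter_upwards [(tendsto_order.1 h).2 c hc] with n hn Qt hQt hm
  exact (sum_sqrt_mul_le_stepSum (hQ n) hQt hm ((hTm n).comp ht) hv hv0 K).trans hn.le

lemma exists_forall_ge_integral_le {f : ℝ → ℝ} (hf : ∀ x, 0 ≤ f x) {ε : ℝ} (hε : 0 < ε) :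
    ∃ Y₀ : ℝ, ∀ Y ≥ Y₀, ∫ x, f x ≤ (∫ x in -Y..Y, f x) + ε := by
  by_cases hi : Integrable f
  · have := intervalIntegral_tendsto_integral hi tendsto_neg_atTop_atBot tendsto_id
    obtain ⟨Y₀, h⟩ := eventually_atTop.1 ((tendsto_order.1 this).1 _ (sub_lt_self _ hε))
    exact ⟨Y₀, fun Y hY => (sub_lt_iff_lt_add.1 (h Y hY)).le⟩
  · refine ⟨0, fun Y hY => ?_⟩
    rw [integral_undef hi]
    have := intervalIntegral.integral_nonneg (μ := volume) (f := f) (a := -Y) (b := Y)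
      (by linarith) fun x _ => hf x
    linarith

lemma integral_sqrt_deriv_mul_le {A : ℝ → ℝ} (hA : Monotone A) (hA1 : ContDiff ℝ 1 A)
    (hν : 0 < ν) {x y : ℝ} (hxy : x ≤ y) :
    ∫ z in x..y, Real.sqrt (deriv A z * normPDF μ ν z) ≤
      Real.sqrt ((A y - A x) * (normCDF μ ν y - normCDF μ ν x)) := by
  have hc : Continuous (deriv A) := hA1.continuous_deriv le_rfl
  have h1 : ∫ z in x..y, deriv A z = A y - A x :=
    intervalIntegral.integral_deriv_eq_sub
      (fun z _ => (hA1.differentiable one_ne_zero).differentiableAt) (hc.intervalIntegrable _ _)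
  rw [← h1, normCDF_sub μ hν, intervalIntegral.integral_of_le hxy,
    intervalIntegral.integral_of_le hxy, intervalIntegral.integral_of_le hxy]
  exact integral_sqrt_mul_le (hc.integrableOn_Ioc) (continuous_normPDF μ ν).integrableOn_Ioc
    (ae_of_all _ fun z => hA.deriv_nonneg) (ae_of_all _ fun z => (normPDF_pos μ hν z).le)

lemma eventually_exists_fidelity_ge (hP : ∀ n, IsProbVec (P n)) (hQ : ∀ n, IsProbVec (Q n))
    (e : ∀ n, κ n ≃ ι n) (hTm : ∀ n, Monotone (T n))
    (hT : ∀ y z, y < z → Tendsto (fun n => T n z - T n y) atTop atTop) (hν : 0 < ν)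
    (hlimP : ∀ y, Tendsto (fun n => upMass (P n) (T n y)) atTop (𝓝 (normCDF μ ν y)))
    (hlimQ : ∀ y, Tendsto (fun n => upMass (Q n) (T n y)) atTop (𝓝 (Phi y)))
    {A : ℝ → ℝ} (hA : Monotone A) (hA1 : ContDiff ℝ 1 A) (hA2 : ∀ x, A x ≤ 1)
    (hA3 : ∀ x, Phi x ≤ A x) {ε : ℝ} (hε : 0 < ε) :
    ∀ᶠ n in atTop, ∃ Qt : κ n → ℝ, IsProbVec Qt ∧ Majorises (P n) Qt ∧
      (∫ x, Real.sqrt (deriv A x * normPDF μ ν x)) - ε ≤ ∑ i, Real.sqrt (Q n i * Qt i) := by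
  set I := ∫ x, Real.sqrt (deriv A x * normPDF μ ν x)
  set G := normCDF μ ν
  obtain ⟨δ, hδ, hδ1, hδ0⟩ : ∃ δ : ℝ, I - ε < Real.sqrt (1 - δ) * (I - ε / 2) ∧ δ < 1 ∧ 0 < δ := by
    have h : ContinuousAt (fun δ : ℝ => Real.sqrt (1 - δ) * (I - ε / 2)) 0 := by fun_prop
    have h1 : ∀ᶠ δ in 𝓝 (0 : ℝ), I - ε < Real.sqrt (1 - δ) * (I - ε / 2) :=
      h.eventually (eventually_gt_nhds (by simp; linarith))
    have h2 := (h1.and (eventually_lt_nhds one_pos)).filter_mono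
      (nhdsWithin_le_nhds (s := Set.Ioi 0))
    obtain ⟨δ, h, h'⟩ := (h2.and eventually_mem_nhdsWithin).exists
    exact ⟨δ, h.1, h.2, h'⟩
  obtain ⟨Y₀, hY₀⟩ := exists_forall_ge_integral_le
    (fun x => Real.sqrt_nonneg (deriv A x * normPDF μ ν x)) (half_pos hε)
  obtain ⟨Y, hY, hYδ, hY0⟩ : ∃ Y, Y₀ ≤ Y ∧ Phi (-Y) < δ ∧ 0 < Y :=
    ((eventually_ge_atTop Y₀).and ((((tendsto_normCDF_atBot 0 one_pos).comp
      tendsto_neg_atTop_atBot).eventually (eventually_lt_nhds hδ0)).and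
      (eventually_gt_atTop 0))).exists
  have hF1 : Phi Y < 1 := normCDF_lt_one 0 one_pos Y
  have hFm : Monotone Phi := (strictMono_normCDF 0 one_pos).monotone
  obtain ⟨K, hK⟩ := exists_nat_gt (2 * Y / (δ * (1 - Phi Y)))
  have hpos : 0 < δ * (1 - Phi Y) := mul_pos hδ0 (sub_pos.2 hF1)
  have hK0 : (0 : ℝ) < K := lt_of_le_of_lt (by positivity) hK
  set h := 2 * Y / K with hh
  have hh0 : 0 < h := by positivity
  have hhK : h < δ * (1 - Phi Y) := by
    rw [div_lt_iff₀ hpos] at hK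
    rw [hh, div_lt_iff₀ hK0]
    linarith
  have hKh : K * h = 2 * Y := by rw [hh]; field_simp
  let y : ℕ → ℝ := fun j => -Y + j * h
  have hy : StrictMono y := fun i j hij => by
    have : (i : ℝ) < j := by exact_mod_cast hij
    simp only [y]
    nlinarith
  have hy0 : y 0 = -Y := by simp [y]
  have hyK : y K = Y := by simp only [y, hKh]; ring
  have hys : ∀ j, y (j + 1) = y j + h := fun j => by simp only [y]; push_cast; ring
  let a : ℕ → ℝ := fun j => if j < K then A (y j) else 1
  have ha : Monotone a := fun i j hij => by
    simp only [a]
    split_ifs with h1 h2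
    · exact hA (hy.monotone hij)
    · exact hA2 _
    · omega
    · exact le_rfl
  have hA0 : ∀ x, 0 ≤ A x := fun x => (normCDF_pos 0 one_pos x).le.trans (hA3 x)
  have haA : ∀ j, A (y j) ≤ a j := fun j => by
    simp only [a]; split_ifs
    exacts [le_rfl, hA2 _]
  have hGs : StrictMono G := strictMono_normCDF μ hν
  have hkQ := tendsto_kMaxSum_floor hQ hT (continuous_normCDF 0 one_pos) hlimQ
  have hlim : Tendsto (fun n => Real.sqrt (1 - δ) * ∑ l ∈ Finset.range K,
      Real.sqrt ((a (l + 1) - a l) * (upMass (P n) (T n (y (l + 1))) - upMass (P n) (T n (y l)))))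
      atTop (𝓝 (Real.sqrt (1 - δ) * ∑ l ∈ Finset.range K,
        Real.sqrt ((a (l + 1) - a l) * (G (y (l + 1)) - G (y l))))) :=
    (tendsto_finsetSum _ fun l _ => (((hlimP _).sub (hlimP _)).const_mul _).sqrt).const_mul _
  have hI : I - ε / 2 ≤ ∑ l ∈ Finset.range K,
      Real.sqrt ((a (l + 1) - a l) * (G (y (l + 1)) - G (y l))) := by
    have hc : Continuous fun x => Real.sqrt (deriv A x * normPDF μ ν x) :=
      ((hA1.continuous_deriv le_rfl).mul (continuous_normPDF μ ν)).sqrt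
    have h1 := hY₀ Y hY
    have h2 := intervalIntegral.sum_integral_adjacent_intervals (a := y) (n := K) (μ := volume)
      fun k _ => hc.intervalIntegrable _ _
    rw [hy0, hyK] at h2
    rw [← h2] at h1
    refine (sub_le_iff_le_add.2 h1).trans (Finset.sum_le_sum fun l hl => ?_)
    refine (integral_sqrt_deriv_mul_le hA hA1 hν (hy l.lt_succ_self).le).trans
      (Real.sqrt_le_sqrt (mul_le_mul_of_nonneg_right ?_ (sub_nonneg.2 (hGs (hy l.lt_succ_self)).le)))
    rw [show a l = A (y l) from if_pos (Finset.mem_range.1 hl)]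
    exact sub_le_sub_right (haA _) _
  have hev : ∀ᶠ n in atTop, ∀ l ∈ Finset.range K,
      upMass (P n) (T n (y l)) < upMass (P n) (T n (y (l + 1))) ∧
      kMaxSum (Q n) ⌊Real.exp (T n (y (l + 1)))⌋₊ ≤ δ + (1 - δ) * a l := by
    rw [Filter.eventually_all_finset]
    intro l hl
    have hlK := Finset.mem_range.1 hl
    refine ((hlimP (y l)).eventually_lt (hlimP (y (l + 1))) (hGs (hy l.lt_succ_self))).and ?_
    refine ((hkQ (y (l + 1))).eventually (eventually_lt_nhds ?_)).mono fun n hn => hn.le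
    have h1 := Phi_sub_le (hy (Nat.lt_succ_self l)).le
    have h2 : a l = A (y l) := if_pos hlK
    have h3 := hA3 (y l)
    have h4 : Phi (y l) ≤ Phi Y := hFm (hyK ▸ hy.monotone hlK.le)
    rw [hys] at h1
    rw [h2, hys]
    change Phi (y l + h) < _
    nlinarith
  filter_upwards [hev, (hlimP (y 0)).eventually (eventually_gt_nhds (normCDF_pos μ hν _)),
    (hkQ (y 0)).eventually (eventually_lt_nhds (hy0 ▸ hYδ)),
    hlim.eventually (eventually_gt_nhds (hδ.trans_le
      (mul_le_mul_of_nonneg_left hI (Real.sqrt_nonneg _))))] with n h1 h2 h3 h4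
  obtain ⟨Qt, g1, g2, g3⟩ := exists_majorised_of_thresholds (hP n) (hQ n) (e n)
    (t := fun j => T n (y j)) (K := K) (fun i j hij => hTm n (hy.monotone hij)) ha
    ((hA0 _).trans (haA 0)) (if_neg (lt_irrefl K)) h2 (fun l hl => (h1 l (Finset.mem_range.2 hl)).1)
    hδ0.le hδ1.le h3.le fun l hl => (h1 l (Finset.mem_range.2 hl)).2
  exact ⟨Qt, g1, g2, h4.le.trans g3⟩

end SequenceLimits

section OptimalRatio

open MeasureTheory Topology

/-- `L` is a likelihood ratio which certifies optimality in the variational problem defining the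
Rayleigh-normal distribution: `L` is antitone, `L · Φ'_{μ,ν}` integrates to one, the sign of
`L · Φ'_{μ,ν} - Φ'` changes at most once, and `L` is constant off the set where
`L · Φ'_{μ,ν} = Φ'`. -/
structure IsOptimalRatio (μ ν : ℝ) (L : ℝ → ℝ) : Prop where
  continuous : Continuous L
  antitone : Antitone L
  pos : ∀ y, 0 < L y
  eq_or_eq : ∃ c, ∀ y, L y = c ∨ L y * normPDF μ ν y = normPDF 0 1 y
  crossing : ∃ y₁, (∀ y ≤ y₁, normPDF 0 1 y ≤ L y * normPDF μ ν y) ∧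
    ∀ y > y₁, L y * normPDF μ ν y ≤ normPDF 0 1 y
  integral_eq_one : ∫ y, L y * normPDF μ ν y = 1

variable {μ ν : ℝ} {L : ℝ → ℝ}

lemma integrable_mul_normPDF_of_eq_or_eq (hν : 0 < ν) (hc : Continuous L) (hpos : ∀ y, 0 < L y)
    {c : ℝ} (h : ∀ y, L y = c ∨ L y * normPDF μ ν y = normPDF 0 1 y) :
    Integrable fun y => L y * normPDF μ ν y := by
  refine (((integrable_normPDF μ hν).const_mul |c|).add (integrable_normPDF 0 one_pos)).mono'
    (hc.mul (continuous_normPDF μ ν)).aestronglyMeasurable (ae_of_all _ fun y => ?_)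
  have h0 := normPDF_pos 0 one_pos y
  have h1 := normPDF_pos μ hν y
  rw [Real.norm_of_nonneg (mul_pos (hpos y) h1).le]
  simp only [Pi.add_apply]
  rcases h y with h | h
  · have := mul_le_mul_of_nonneg_right (le_abs_self c) h1.le
    rw [h]
    linarith
  · rw [h]
    have := mul_nonneg (abs_nonneg c) h1.le
    linarith

namespace IsOptimalRatio

lemma integrable (h : IsOptimalRatio μ ν L) (hν : 0 < ν) :
    Integrable fun y => L y * normPDF μ ν y := by
  obtain ⟨c, hc⟩ := h.eq_or_eq
  exact integrable_mul_normPDF_of_eq_or_eq hν h.continuous h.pos hc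

lemma exists_eq_integral (h : IsOptimalRatio μ ν L) (hν : 0 < ν) :
    ∃ A : ℝ → ℝ, Monotone A ∧ ContDiff ℝ 1 A ∧ (∀ x, A x ≤ 1) ∧ (∀ x, Phi x ≤ A x) ∧
      ∫ x, Real.sqrt (deriv A x * normPDF μ ν x) = ∫ x, Real.sqrt (L x) * normPDF μ ν x := by
  have hg0 : ∀ y, 0 < normPDF μ ν y := normPDF_pos μ hν
  have hi := h.integrable hν
  have hf := integrable_normPDF 0 one_pos
  have hcont : Continuous fun y => L y * normPDF μ ν y := h.continuous.mul (continuous_normPDF μ ν)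
  have hL0 : ∀ y, 0 ≤ L y * normPDF μ ν y := fun y => (mul_pos (h.pos y) (hg0 y)).le
  let A : ℝ → ℝ := fun x => ∫ y in Set.Iic x, L y * normPDF μ ν y
  have hA : ∀ x, HasDerivAt A (L x * normPDF μ ν x) x := fun x => by
    have e : A = fun y => A 0 + ∫ t in (0 : ℝ)..y, L t * normPDF μ ν t := by
      funext y
      rw [← intervalIntegral.integral_Iic_sub_Iic hi.integrableOn hi.integrableOn]
      simp only [A]
      ring
    rw [e]
    exact (intervalIntegral.integral_hasDerivAt_right (hcont.intervalIntegrable _ _)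
      hcont.stronglyMeasurable.stronglyMeasurableAtFilter hcont.continuousAt).const_add _
  have hd : deriv A = fun x => L x * normPDF μ ν x := funext fun x => (hA x).deriv
  refine ⟨A, monotone_of_deriv_nonneg (fun x => (hA x).differentiableAt) fun x => hd ▸ hL0 x,
    contDiff_one_iff_deriv.2 ⟨fun x => (hA x).differentiableAt, hd ▸ hcont⟩, fun x => ?_,
    fun x => ?_, ?_⟩
  · rw [← h.integral_eq_one]
    exact setIntegral_le_integral hi (ae_of_all _ hL0)
  · obtain ⟨y₁, h1, h2⟩ := h.crossing
    rcases le_or_gt x y₁ with hx | hx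
    · exact setIntegral_mono_on hf.integrableOn hi.integrableOn measurableSet_Iic
        fun y hy => h1 y (le_trans hy hx)
    · have e1 := intervalIntegral.integral_Iic_add_Ioi hi.integrableOn hi.integrableOn (b := x)
      have e2 := intervalIntegral.integral_Iic_add_Ioi hf.integrableOn hf.integrableOn (b := x)
      rw [h.integral_eq_one] at e1
      rw [integral_normPDF 0 one_pos] at e2
      have e3 : ∫ y in Set.Ioi x, L y * normPDF μ ν y ≤ ∫ y in Set.Ioi x, normPDF 0 1 y :=
        setIntegral_mono_on hi.integrableOn hf.integrableOn measurableSet_Ioi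
          fun y hy => h2 y (lt_trans hx hy)
      change ∫ y in Set.Iic x, normPDF 0 1 y ≤ ∫ y in Set.Iic x, L y * normPDF μ ν y
      linarith
  · refine integral_congr_ae (ae_of_all _ fun x => ?_)
    simp only [hd]
    rw [mul_assoc, Real.sqrt_mul (h.pos x).le, Real.sqrt_mul_self (hg0 x).le]

lemma integrable_sqrt (h : IsOptimalRatio μ ν L) (hν : 0 < ν) :
    Integrable fun y => Real.sqrt (L y) * normPDF μ ν y := by
  refine ((integrable_normPDF μ hν).add (h.integrable hν)).mono'
    (h.continuous.sqrt.mul (continuous_normPDF μ ν)).aestronglyMeasurable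
    (ae_of_all _ fun y => ?_)
  have h1 := normPDF_pos μ hν y
  rw [Real.norm_of_nonneg (mul_nonneg (Real.sqrt_nonneg _) h1.le)]
  simp only [Pi.add_apply]
  have : Real.sqrt (L y) ≤ 1 + L y := by
    rw [Real.sqrt_le_left (by linarith [h.pos y])]
    nlinarith [h.pos y]
  nlinarith

lemma inv_sqrt (h : IsOptimalRatio μ ν L) (hν : 0 < ν) :
    Integrable (fun y => (Real.sqrt (L y))⁻¹ * normPDF 0 1 y) ∧
      ∫ y, (Real.sqrt (L y))⁻¹ * normPDF 0 1 y = ∫ y, Real.sqrt (L y) * normPDF μ ν y := by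
  obtain ⟨c, hc⟩ := h.eq_or_eq
  have e : (fun y => (Real.sqrt (L y))⁻¹ * normPDF 0 1 y) = fun y =>
      Real.sqrt (L y) * normPDF μ ν y
        - (Real.sqrt c)⁻¹ * (L y * normPDF μ ν y - normPDF 0 1 y) := by
    funext y
    have hs : Real.sqrt (L y) ≠ 0 := (Real.sqrt_pos.2 (h.pos y)).ne'
    have hLs : L y = Real.sqrt (L y) * Real.sqrt (L y) := (Real.mul_self_sqrt (h.pos y).le).symm
    rcases hc y with h' | h'
    · rw [← h']
      nth_rw 4 [hLs]
      field_simp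
      ring
    · rw [h', sub_self, mul_zero, sub_zero, ← h']
      nth_rw 2 [hLs]
      field_simp
  have hd : Integrable fun y => L y * normPDF μ ν y - normPDF 0 1 y :=
    (h.integrable hν).sub (integrable_normPDF 0 one_pos)
  have i1 := h.integrable_sqrt hν
  rw [e]
  refine ⟨i1.sub (hd.const_mul _), ?_⟩
  rw [integral_sub i1 (hd.const_mul _), integral_const_mul,
    integral_sub (h.integrable hν) (integrable_normPDF 0 one_pos), h.integral_eq_one,
    integral_normPDF 0 one_pos]
  simp

end IsOptimalRatio

lemma integral_stepSum_mul_normPDF (hν : 0 < ν) (v : ℕ → ℝ) (K : ℕ) (t : ℕ → ℝ) :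
    Integrable (fun y => stepSum v K (fun j => if y ≤ t j then 1 else 0) * normPDF μ ν y) ∧
    ∫ y, stepSum v K (fun j => if y ≤ t j then 1 else 0) * normPDF μ ν y =
      stepSum v K fun j => normCDF μ ν (t j) := by
  have hg := integrable_normPDF μ hν
  have e : (fun y => stepSum v K (fun j => if y ≤ t j then 1 else 0) * normPDF μ ν y) = fun y =>
      v K * normPDF μ ν y + ∑ j ∈ Finset.range K,
        (v j - v (j + 1)) * (Set.Iic (t j)).indicator (normPDF μ ν) y := by
    funext y
    rw [stepSum, add_mul, Finset.sum_mul]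
    congr 1
    refine Finset.sum_congr rfl fun j _ => ?_
    rw [mul_assoc, Set.indicator_apply]
    simp [ite_mul]
  have hi : ∀ j ∈ Finset.range K, Integrable fun y =>
      (v j - v (j + 1)) * (Set.Iic (t j)).indicator (normPDF μ ν) y :=
    fun j _ => (hg.indicator measurableSet_Iic).const_mul _
  rw [e]
  refine ⟨(hg.const_mul _).add (integrable_finsetSum _ hi), ?_⟩
  rw [integral_add (hg.const_mul _) (integrable_finsetSum _ hi), integral_finsetSum _ hi,
    integral_const_mul, integral_normPDF μ hν, mul_one, stepSum]
  congr 1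
  refine Finset.sum_congr rfl fun j _ => ?_
  rw [integral_const_mul, integral_indicator measurableSet_Iic, normCDF]

lemma IsOptimalRatio.exists_stepSum_lt (h : IsOptimalRatio μ ν L) (hν : 0 < ν) {ε : ℝ}
    (hε : 0 < ε) :
    ∃ (t v : ℕ → ℝ) (K : ℕ), Monotone t ∧ Antitone v ∧ (∀ j, 0 < v j) ∧
      (stepSum v K (fun j => normCDF μ ν (t j)) + stepSum (fun j => (v j)⁻¹) K fun j => Phi (t j))
        / 2 < (∫ y, Real.sqrt (L y) * normPDF μ ν y) + ε := by
  set l : ℝ → ℝ := fun y => Real.sqrt (L y) with hl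
  have hl0 : ∀ y, 0 < l y := fun y => Real.sqrt_pos.2 (h.pos y)
  have hla : Antitone l := fun x y hxy => Real.sqrt_le_sqrt (h.antitone hxy)
  have hlc : Continuous l := h.continuous.sqrt
  have hlm : ∀ {x y}, x ≤ y → (l x)⁻¹ ≤ (l y)⁻¹ := fun {x y} hxy =>
    inv_anti₀ (hl0 y) (hla hxy)
  obtain ⟨Y, hY1, hY2, hY0⟩ : ∃ Y, 1 - ε / (2 * l 0) < normCDF μ ν Y ∧
      Phi (-Y) < ε / 2 * l 0 ∧ 0 < Y :=
    (((tendsto_normCDF_atTop μ hν).eventually (eventually_gt_nhds (sub_lt_self _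
      (div_pos hε (mul_pos two_pos (hl0 0)))))).and ((((tendsto_normCDF_atBot 0 one_pos).comp
      tendsto_neg_atTop_atBot).eventually (eventually_lt_nhds
        (mul_pos (half_pos hε) (hl0 0)))).and (eventually_gt_atTop 0))).exists
  obtain ⟨δ, hδ0, hδ⟩ := Metric.uniformContinuousOn_iff.1
    ((isCompact_Icc (a := -Y) (b := Y)).uniformContinuousOn_of_continuous
      (hlc.inv₀ fun y => (hl0 y).ne').continuousOn) (ε / 2) (half_pos hε)
  obtain ⟨K, hK⟩ := exists_nat_gt (2 * Y / δ)
  have hK0 : (0 : ℝ) < K := lt_of_le_of_lt (by positivity) hK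
  set s := 2 * Y / K with hs
  have hs0 : 0 < s := by positivity
  have hsδ : s < δ := by
    rw [div_lt_iff₀ hδ0] at hK
    rw [hs, div_lt_iff₀ hK0]
    linarith
  have hKs : K * s = 2 * Y := by rw [hs]; field_simp
  let t : ℕ → ℝ := fun j => -Y + j * s
  have ht : Monotone t := fun i j hij => by
    have : (i : ℝ) ≤ j := by exact_mod_cast hij
    simp only [t]
    nlinarith
  have ht0 : t 0 = -Y := by simp [t]
  have htK : t K = Y := by simp only [t, hKs]; ring
  have hts : ∀ j, t (j + 1) = t j + s := fun j => by simp only [t]; push_cast; ring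
  refine ⟨t, fun j => l (t j), K, ht, fun i j hij => hla (ht hij), fun j => hl0 _, ?_⟩
  obtain ⟨i1, e1⟩ := integral_stepSum_mul_normPDF (μ := μ) hν (fun j => l (t j)) K t
  obtain ⟨i2, e2⟩ := integral_stepSum_mul_normPDF (μ := 0) one_pos (fun j => (l (t j))⁻¹) K t
  have hstep : ∀ y, ∃ k ≤ K, (∀ j < k, t j < y) ∧ (k < K → y ≤ t k) ∧
      ∀ v : ℕ → ℝ, stepSum v K (fun j => if y ≤ t j then 1 else 0) = v k := fun y => by
    obtain ⟨k, hk, h1, h2, h3⟩ := exists_stepSum_indicator_eq K (fun j => y ≤ t j)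
      fun j hj => hj.trans (ht j.le_succ)
    exact ⟨k, hk, fun j hj => not_le.1 (h1 j hj), h2, h3⟩
  have hg := integrable_normPDF μ hν
  have hf := integrable_normPDF 0 one_pos
  obtain ⟨i4, e4⟩ := h.inv_sqrt hν
  have i3 := h.integrable_sqrt hν
  have b1 : stepSum (fun j => l (t j)) K (fun j => normCDF μ ν (t j)) ≤
      (∫ y, l y * normPDF μ ν y) + l 0 * (1 - normCDF μ ν Y) := by
    have j1 := (hg.indicator (measurableSet_Ioi (a := Y))).const_mul (l 0)
    have e5 : ∫ y in Set.Ioi Y, normPDF μ ν y = 1 - normCDF μ ν Y := by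
      rw [← integral_normPDF μ hν, ← intervalIntegral.integral_Iic_add_Ioi
        hg.integrableOn hg.integrableOn (b := Y)]
      simp [normCDF]
    rw [← e1, ← e5, ← integral_indicator measurableSet_Ioi, ← integral_const_mul,
      ← integral_add i3 j1]
    refine integral_mono i1 (i3.add j1) fun y => ?_
    obtain ⟨k, hk, h1, h2, h3⟩ := hstep y
    simp only [h3]
    have hgy := normPDF_pos μ hν y
    rcases le_or_gt y Y with hy | hy
    · rw [Set.indicator_of_notMem (by simpa using hy), mul_zero, add_zero]
      refine mul_le_mul_of_nonneg_right (hla ?_) hgy.le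
      rcases hk.lt_or_eq with hk | rfl
      exacts [h2 hk, htK ▸ hy]
    · rw [Set.indicator_of_mem (by simpa using hy)]
      have hkK : k = K := by
        by_contra hne
        exact absurd ((h2 (lt_of_le_of_ne hk hne)).trans (ht hk)) (by rw [htK]; exact not_le.2 hy)
      have : l (t k) ≤ l 0 := hla (by rw [hkK, htK]; exact hY0.le)
      nlinarith [hl0 y]
  have b2 : stepSum (fun j => (l (t j))⁻¹) K (fun j => Phi (t j)) ≤
      (∫ y, (l y)⁻¹ * normPDF 0 1 y) + (ε / 2 + (l 0)⁻¹ * Phi (-Y)) := by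
    have j1 := (hf.indicator (measurableSet_Iic (a := -Y))).const_mul (l 0)⁻¹
    have j2 := hf.const_mul (ε / 2)
    have j3 : Integrable fun y => ε / 2 * normPDF 0 1 y +
        (l 0)⁻¹ * (Set.Iic (-Y)).indicator (normPDF 0 1) y := j2.add j1
    have e5 : ∫ y, (ε / 2) * normPDF 0 1 y = ε / 2 := by
      rw [integral_const_mul, integral_normPDF 0 one_pos, mul_one]
    have e6 : ∫ y, (l 0)⁻¹ * (Set.Iic (-Y)).indicator (normPDF 0 1) y = (l 0)⁻¹ * Phi (-Y) := by
      rw [integral_const_mul, integral_indicator measurableSet_Iic, Phi, normCDF]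
    calc _ = _ := e2.symm
      _ ≤ ∫ y, (l y)⁻¹ * normPDF 0 1 y + (ε / 2 * normPDF 0 1 y +
          (l 0)⁻¹ * (Set.Iic (-Y)).indicator (normPDF 0 1) y) := by
        refine integral_mono i2 (i4.add j3) fun y => ?_
        obtain ⟨k, hk, h1, h2, h3⟩ := hstep y
        simp only [h3]
        have hfy := normPDF_pos 0 one_pos y
        have hi0 : 0 < (l 0)⁻¹ := inv_pos.2 (hl0 0)
        have hiy : 0 < (l y)⁻¹ := inv_pos.2 (hl0 y)
        have hind : 0 ≤ (Set.Iic (-Y)).indicator (normPDF 0 1) y :=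
          Set.indicator_nonneg (fun z _ => (normPDF_pos 0 one_pos z).le) y
        rcases Nat.eq_zero_or_pos k with rfl | hk0
        · have hy : y ≤ -Y := ht0 ▸ h2 (by exact_mod_cast hK0)
          rw [Set.indicator_of_mem (by simpa using hy)]
          have : (l (t 0))⁻¹ ≤ (l 0)⁻¹ := hlm (by rw [ht0]; linarith)
          nlinarith
        · suffices (l (t k))⁻¹ ≤ (l y)⁻¹ + ε / 2 by nlinarith
          obtain ⟨k, rfl⟩ := Nat.exists_eq_add_of_lt hk0
          simp only [zero_add] at *
          have hm : ∀ j ≤ K, t j ∈ Set.Icc (-Y) Y := fun j hj =>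
            ⟨ht0 ▸ ht j.zero_le, htK ▸ ht hj⟩
          have h5 := hδ (t (k + 1)) (hm _ hk) (t k) (hm _ (by omega)) (by
            rw [hts, Real.dist_eq, add_sub_cancel_left, abs_of_pos hs0]; exact hsδ)
          have h6 := hlm (h1 k k.lt_succ_self).le
          rw [Real.dist_eq, Pi.inv_apply, Pi.inv_apply] at h5
          have := le_abs_self ((l (t (k + 1)))⁻¹ - (l (t k))⁻¹)
          linarith
      _ = _ := by
        rw [integral_add i4 j3, ← e6]
        congr 1
        rw [integral_add j2 j1, e5]
  have b3 : l 0 * (1 - normCDF μ ν Y) < ε / 2 := by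
    have : 1 - normCDF μ ν Y < ε / (2 * l 0) := by linarith
    rw [lt_div_iff₀ (mul_pos two_pos (hl0 0))] at this
    linarith
  have b4 : (l 0)⁻¹ * Phi (-Y) < ε / 2 := by
    rw [inv_mul_lt_iff₀ (hl0 0), mul_comm]
    exact hY2
  rw [e4] at b2
  simp only [hl] at b1 b2 b3 b4 ⊢
  linarith

end OptimalRatio

section ExistsOptimalRatio

open MeasureTheory Topology

/-- The ratio of the standard normal density and that of the normal distribution with mean `μ` and
variance `ν`. -/
def normRatio (μ ν x : ℝ) : ℝ := Real.sqrt ν * Real.exp ((x - μ) ^ 2 / (2 * ν) - x ^ 2 / 2)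

variable {μ ν : ℝ}

lemma normRatio_mul_normPDF (hν : 0 < ν) (x : ℝ) :
    normRatio μ ν x * normPDF μ ν x = normPDF 0 1 x := by
  have h1 : Real.sqrt (2 * Real.pi * ν) = Real.sqrt (2 * Real.pi) * Real.sqrt ν :=
    Real.sqrt_mul (by positivity) _
  have h2 : 0 < Real.sqrt ν := Real.sqrt_pos.2 hν
  have h3 : 0 < Real.sqrt (2 * Real.pi) := by positivity
  rw [normRatio, normPDF, normPDF, h1, mul_one, mul_one]
  have : Real.exp (-(x - 0) ^ 2 / 2) = Real.exp ((x - μ) ^ 2 / (2 * ν) - x ^ 2 / 2) *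
      Real.exp (-(x - μ) ^ 2 / (2 * ν)) := by
    rw [← Real.exp_add]
    congr 1
    ring
  rw [this]
  field_simp

lemma normRatio_pos (hν : 0 < ν) (x : ℝ) : 0 < normRatio μ ν x := by
  unfold normRatio
  positivity

lemma continuous_normRatio : Continuous (normRatio μ ν) := by
  unfold normRatio
  fun_prop

lemma normRatio_le_normRatio {x y : ℝ} (h : (x - μ) ^ 2 / (2 * ν) - x ^ 2 / 2 ≤
    (y - μ) ^ 2 / (2 * ν) - y ^ 2 / 2) : normRatio μ ν x ≤ normRatio μ ν y :=
  mul_le_mul_of_nonneg_left (Real.exp_le_exp.2 h) (Real.sqrt_nonneg _)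

lemma normRatio_exponent_eq (hν : 0 < ν) (h1 : ν ≠ 1) (x : ℝ) :
    (x - μ) ^ 2 / (2 * ν) - x ^ 2 / 2 =
      (1 / ν - 1) / 2 * (x - μ / (1 - ν)) ^ 2 + μ ^ 2 / (2 * (ν - 1)) * 1 := by
  have h2 : 1 - ν ≠ 0 := sub_ne_zero.2 h1.symm
  have h3 : ν - 1 ≠ 0 := sub_ne_zero.2 h1
  field_simp
  ring

lemma integral_eq_add_of_split {f g h : ℝ → ℝ} (a : ℝ) (hf : Integrable f)
    (h1 : ∀ y ≤ a, f y = g y) (h2 : ∀ y > a, f y = h y) :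
    ∫ y, f y = (∫ y in Set.Iic a, g y) + ∫ y in Set.Ioi a, h y := by
  rw [← intervalIntegral.integral_Iic_add_Ioi hf.integrableOn hf.integrableOn (b := a),
    setIntegral_congr_fun measurableSet_Iic h1, setIntegral_congr_fun measurableSet_Ioi h2]

lemma integral_Ioi_normPDF (hν : 0 < ν) (x : ℝ) :
    ∫ y in Set.Ioi x, normPDF μ ν y = 1 - normCDF μ ν x := by
  have hg := integrable_normPDF μ hν
  rw [← integral_normPDF μ hν, ← intervalIntegral.integral_Iic_add_Ioi
    hg.integrableOn hg.integrableOn (b := x)]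
  simp [normCDF]

lemma exists_isOptimalRatio_of_eq_one (μ : ℝ) : ∃ L, IsOptimalRatio μ 1 L := by
  rcases le_or_gt 0 μ with hμ | hμ
  · have h := fun x => normRatio_mul_normPDF (μ := μ) one_pos x
    refine ⟨normRatio μ 1, continuous_normRatio, fun x y hxy => normRatio_le_normRatio ?_,
      normRatio_pos one_pos, ⟨0, fun y => Or.inr (h y)⟩,
      ⟨0, fun y _ => (h y).ge, fun y _ => (h y).le⟩, ?_⟩
    · nlinarith
    · simp_rw [h]
      exact integral_normPDF 0 one_pos
  · have h1 : normRatio μ 1 (μ / 2) = 1 := by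
      rw [normRatio, Real.sqrt_one, one_mul, Real.exp_eq_one_iff]
      ring
    refine ⟨fun _ => 1, continuous_const, antitone_const, fun _ => one_pos,
      ⟨1, fun y => Or.inl rfl⟩, ⟨μ / 2, fun y hy => ?_, fun y hy => ?_⟩, ?_⟩
    · rw [← normRatio_mul_normPDF one_pos]
      refine mul_le_mul_of_nonneg_right ((normRatio_le_normRatio ?_).trans_eq h1) (normPDF_pos μ one_pos y).le
      nlinarith
    · rw [← normRatio_mul_normPDF one_pos]
      refine mul_le_mul_of_nonneg_right (h1.symm.trans_le (normRatio_le_normRatio ?_)) (normPDF_pos μ one_pos y).le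
      nlinarith
    · simp only [one_mul]
      exact integral_normPDF μ one_pos

lemma exists_isOptimalRatio_of_one_lt (μ : ℝ) (h1 : 1 < ν) : ∃ L, IsOptimalRatio μ ν L := by
  have hν : 0 < ν := one_pos.trans h1
  set y₀ := μ / (1 - ν)
  have ha : (1 / ν - 1) / 2 < 0 := by
    have : 1 / ν < 1 := (div_lt_one hν).2 h1
    linarith
  have hmono : ∀ {x y : ℝ}, (y - y₀) ^ 2 ≤ (x - y₀) ^ 2 → normRatio μ ν x ≤ normRatio μ ν y :=
    fun {x y} h => normRatio_le_normRatio (by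
      rw [normRatio_exponent_eq hν h1.ne', normRatio_exponent_eq hν h1.ne']
      nlinarith)
  have hr := fun x => normRatio_mul_normPDF (μ := μ) hν x
  have hf := integrable_normPDF 0 one_pos
  have hg := integrable_normPDF μ hν
  have hg0 := fun x => (normPDF_pos μ hν x).le
  obtain ⟨y', hy', hroot⟩ : ∃ y' ≥ y₀, normRatio μ ν y' * normCDF μ ν y' = Phi y' := by
    have hΨ : Continuous fun y => normRatio μ ν y * normCDF μ ν y - Phi y :=
      (continuous_normRatio.mul (continuous_normCDF μ hν)).sub (continuous_normCDF 0 one_pos)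
    have hlim : Tendsto (normRatio μ ν) atTop (𝓝 0) := by
      have h2 : Tendsto (fun x : ℝ => (x - y₀) ^ 2) atTop atTop :=
        (tendsto_pow_atTop two_ne_zero).comp (tendsto_atTop_add_const_right _ (-y₀) tendsto_id)
      have h3 := (Real.tendsto_exp_atBot.comp (tendsto_atBot_add_const_right _
        (μ ^ 2 / (2 * (ν - 1)) * 1) (h2.const_mul_atTop_of_neg ha))).const_mul (Real.sqrt ν)
      rw [mul_zero] at h3
      refine h3.congr fun x => ?_
      rw [normRatio, normRatio_exponent_eq hν h1.ne']
      rfl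
    obtain ⟨Y, hY, hY0⟩ := ((hlim.eventually (eventually_lt_nhds
      (normCDF_pos 0 one_pos y₀))).and (eventually_ge_atTop y₀)).exists
    have e0 : 0 ≤ normRatio μ ν y₀ * normCDF μ ν y₀ - Phi y₀ := by
      rw [sub_nonneg, normCDF, Phi, normCDF, ← integral_const_mul]
      refine setIntegral_mono hf.integrableOn (hg.const_mul _).integrableOn fun x => ?_
      rw [← hr]
      exact mul_le_mul_of_nonneg_right (hmono (by simpa using sq_nonneg _)) (hg0 x)
    have e1 : normRatio μ ν Y * normCDF μ ν Y - Phi Y ≤ 0 := by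
      have h3 : Phi y₀ ≤ Phi Y := (strictMono_normCDF 0 one_pos).monotone hY0
      have h4 := normCDF_lt_one μ hν Y
      have h5 := normRatio_pos (μ := μ) hν Y
      change _ < Phi y₀ at hY
      nlinarith
    obtain ⟨y', hy', h⟩ := intermediate_value_Icc' hY0 hΨ.continuousOn ⟨e1, e0⟩
    exact ⟨y', hy'.1, sub_eq_zero.1 h⟩
  have hc : Continuous fun y => normRatio μ ν (max y y') :=
    continuous_normRatio.comp (continuous_id.max continuous_const)
  have hor : ∀ y, normRatio μ ν (max y y') = normRatio μ ν y' ∨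
      normRatio μ ν (max y y') * normPDF μ ν y = normPDF 0 1 y := fun y => by
    rcases le_total y y' with h | h
    · left; rw [max_eq_right h]
    · right; rw [max_eq_left h, hr]
  refine ⟨fun y => normRatio μ ν (max y y'), hc, fun x y hxy => hmono ?_,
    fun y => normRatio_pos hν _, ⟨_, hor⟩, ⟨2 * y₀ - y', fun y hy => ?_, fun y hy => ?_⟩, ?_⟩
  · have := max_le_max_right y' hxy
    have := le_max_right x y'
    nlinarith
  · rw [← hr]
    refine mul_le_mul_of_nonneg_right (hmono ?_) (hg0 y)
    rw [max_eq_right (by linarith)]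
    nlinarith
  · rw [← hr y]
    refine mul_le_mul_of_nonneg_right (hmono ?_) (hg0 y)
    rcases le_total y y' with h | h
    · rw [max_eq_right h]
      nlinarith
    · rw [max_eq_left h]
  · rw [integral_eq_add_of_split y' (integrable_mul_normPDF_of_eq_or_eq hν hc
      (fun y => normRatio_pos hν _) hor)
      (fun y hy => by rw [max_eq_right hy]) (fun y hy => by rw [max_eq_left hy.le, hr]),
      integral_const_mul, integral_Ioi_normPDF one_pos]
    change normRatio μ ν y' * normCDF μ ν y' + (1 - Phi y') = 1
    rw [hroot]
    ring

lemma exists_isOptimalRatio_of_lt_one (μ : ℝ) (hν : 0 < ν) (h1 : ν < 1) :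
    ∃ L, IsOptimalRatio μ ν L := by
  set y₀ := μ / (1 - ν)
  have ha : 0 < (1 / ν - 1) / 2 := by
    have : 1 < 1 / ν := (one_lt_div hν).2 h1
    linarith
  have hmono : ∀ {x y : ℝ}, (x - y₀) ^ 2 ≤ (y - y₀) ^ 2 → normRatio μ ν x ≤ normRatio μ ν y :=
    fun {x y} h => normRatio_le_normRatio (by
      rw [normRatio_exponent_eq hν h1.ne, normRatio_exponent_eq hν h1.ne]
      nlinarith)
  have hr := fun x => normRatio_mul_normPDF (μ := μ) hν x
  have hf := integrable_normPDF 0 one_pos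
  have hg := integrable_normPDF μ hν
  have hg0 := fun x => (normPDF_pos μ hν x).le
  obtain ⟨y', hy', hroot⟩ : ∃ y' ≤ y₀,
      normRatio μ ν y' * (1 - normCDF μ ν y') = 1 - Phi y' := by
    have hΨ : Continuous fun y => normRatio μ ν y * (1 - normCDF μ ν y) - (1 - Phi y) :=
      (continuous_normRatio.mul (continuous_const.sub (continuous_normCDF μ hν))).sub
        (continuous_const.sub (continuous_normCDF 0 one_pos))
    have hlim : Tendsto (normRatio μ ν) atBot atTop := by
      have h2 : Tendsto (fun x : ℝ => (x - y₀) ^ 2) atBot atTop :=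
        ((tendsto_pow_atTop two_ne_zero).comp (tendsto_neg_atBot_atTop.comp
          (tendsto_atBot_add_const_right _ (-y₀) tendsto_id))).congr fun x => neg_sq _
      have h3 := (Real.tendsto_exp_atTop.comp (tendsto_atTop_add_const_right _
        (μ ^ 2 / (2 * (ν - 1)) * 1) (h2.const_mul_atTop ha))).const_mul_atTop (Real.sqrt_pos.2 hν)
      refine h3.congr fun x => ?_
      rw [normRatio, normRatio_exponent_eq hν h1.ne]
      rfl
    have hG := normCDF_lt_one μ hν y₀
    obtain ⟨Y, hY, hY0⟩ := ((hlim.eventually (eventually_ge_atTop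
      (1 / (1 - normCDF μ ν y₀)))).and (eventually_le_atBot y₀)).exists
    have e0 : normRatio μ ν y₀ * (1 - normCDF μ ν y₀) - (1 - Phi y₀) ≤ 0 := by
      rw [sub_nonpos, Phi, ← integral_Ioi_normPDF hν, ← integral_Ioi_normPDF one_pos,
        ← integral_const_mul]
      refine setIntegral_mono (hg.const_mul _).integrableOn hf.integrableOn fun x => ?_
      rw [← hr]
      exact mul_le_mul_of_nonneg_right (hmono (by simpa using sq_nonneg _)) (hg0 x)
    have e1 : 0 ≤ normRatio μ ν Y * (1 - normCDF μ ν Y) - (1 - Phi Y) := by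
      have h3 : 0 < Phi Y := normCDF_pos 0 one_pos Y
      have h4 : normCDF μ ν Y ≤ normCDF μ ν y₀ := (strictMono_normCDF μ hν).monotone hY0
      have h5 := normRatio_pos (μ := μ) hν Y
      rw [div_le_iff₀ (sub_pos.2 hG)] at hY
      nlinarith
    obtain ⟨y', hy', h⟩ := intermediate_value_Icc' hY0 hΨ.continuousOn ⟨e0, e1⟩
    exact ⟨y', hy'.2, sub_eq_zero.1 h⟩
  have hc : Continuous fun y => normRatio μ ν (min y y') :=
    continuous_normRatio.comp (continuous_id.min continuous_const)
  have hor : ∀ y, normRatio μ ν (min y y') = normRatio μ ν y' ∨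
      normRatio μ ν (min y y') * normPDF μ ν y = normPDF 0 1 y := fun y => by
    rcases le_total y y' with h | h
    · right; rw [min_eq_left h, hr]
    · left; rw [min_eq_right h]
  refine ⟨fun y => normRatio μ ν (min y y'), hc, fun x y hxy => hmono ?_,
    fun y => normRatio_pos hν _, ⟨_, hor⟩, ⟨2 * y₀ - y', fun y hy => ?_, fun y hy => ?_⟩, ?_⟩
  · have := min_le_min_right y' hxy
    have := min_le_right y y'
    nlinarith
  · rw [← hr y]
    refine mul_le_mul_of_nonneg_right (hmono ?_) (hg0 y)
    rcases le_total y y' with h | h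
    · rw [min_eq_left h]
    · rw [min_eq_right h]
      nlinarith
  · rw [← hr]
    refine mul_le_mul_of_nonneg_right (hmono ?_) (hg0 y)
    rw [min_eq_right (by linarith)]
    nlinarith
  · rw [integral_eq_add_of_split y' (integrable_mul_normPDF_of_eq_or_eq hν hc
      (fun y => normRatio_pos hν _) hor)
      (fun y hy => by rw [min_eq_left hy, hr]) (fun y hy => by rw [min_eq_right hy.le]),
      integral_const_mul, integral_Ioi_normPDF hν, hroot]
    change Phi y' + (1 - Phi y') = 1
    ring

lemma exists_isOptimalRatio (μ : ℝ) (hν : 0 < ν) : ∃ L, IsOptimalRatio μ ν L := by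
  rcases lt_trichotomy ν 1 with h | rfl | h
  · exact exists_isOptimalRatio_of_lt_one μ hν h
  · exact exists_isOptimalRatio_of_eq_one μ
  · exact exists_isOptimalRatio_of_one_lt μ h

end ExistsOptimalRatio

section CentralLimit

open MeasureTheory ProbabilityTheory Topology

variable {d : ℕ} {p : Fin d → ℝ}

lemma IsProbVec.tensorPow (hp : IsProbVec p) (n : ℕ) : IsProbVec (tensorPow p n) := by
  refine ⟨fun f => Finset.prod_nonneg fun j _ => hp.1 _, ?_⟩
  have := Finset.prod_univ_sum (fun _ : Fin n => (Finset.univ : Finset (Fin d))) fun _ i => p i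
  rw [Fintype.piFinset_univ] at this
  simp only [_root_.tensorPow]
  rw [← this, Finset.prod_const, hp.2, one_pow]

lemma gaussianReal_Iic (x : ℝ) : (gaussianReal 0 1 (Set.Iic x)).toReal = Phi x := by
  rw [gaussianReal_apply_eq_integral _ one_ne_zero,
    ENNReal.toReal_ofReal (integral_nonneg fun _ => gaussianPDFReal_nonneg _ _ _), Phi, normCDF,
    normPDF_eq_gaussianPDFReal 0 one_pos]
  rfl

lemma tendsto_sum_tensorPow (hp : IsProbVec p) {Z : Fin d → ℝ} (h1 : ∑ i, p i * Z i = 0)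
    (h2 : ∑ i, p i * Z i ^ 2 = 1) (x : ℝ) :
    Tendsto (fun n : ℕ => ∑ f : Fin n → Fin d,
      if (Real.sqrt n)⁻¹ * ∑ j, Z (f j) ≤ x then tensorPow p n f else 0) atTop (𝓝 (Phi x)) := by
  let pm : PMF (Fin d) := PMF.ofFintype (fun i => ENNReal.ofReal (p i)) (by
    rw [← ENNReal.ofReal_sum_of_nonneg fun i _ => hp.1 i, hp.2, ENNReal.ofReal_one])
  let m : Measure (Fin d) := pm.toMeasure
  have hpm : ∀ i, (pm i).toReal = p i := fun i => ENNReal.toReal_ofReal (hp.1 i)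
  have hm : ∀ i, m.real {i} = p i := fun i => by
    rw [Measure.real, PMF.toMeasure_apply_singleton _ _ (MeasurableSet.singleton i), hpm]
  let W : Measure (ℕ → Fin d) := Measure.infinitePi fun _ => m
  let X : ℕ → (ℕ → Fin d) → ℝ := fun k ω => Z (ω k)
  have hZ : Measurable Z := measurable_of_finite Z
  have hX : ∀ k, Measurable (X k) := fun k => hZ.comp (measurable_pi_apply k)
  have hint : ∀ (g : Fin d → ℝ) (k : ℕ), ∫ ω, g (ω k) ∂W = ∑ i, p i * g i := fun g k => by
    have e : W.map (fun ω => ω k) = m := Measure.infinitePi_map_eval _ k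
    rw [← integral_map (φ := fun ω : ℕ → Fin d => ω k) (f := g)
      (measurable_pi_apply k).aemeasurable (measurable_of_finite g).aestronglyMeasurable, e,
      PMF.integral_eq_sum]
    simp only [hpm, smul_eq_mul]
  have hE : ∫ ω, X 0 ω ∂W = 0 := (hint Z 0).trans h1
  have hV : Var[X 0; W] = 1 := by
    rw [variance_eq_integral (hX 0).aemeasurable, hE]
    simp only [sub_zero]
    exact (hint (fun i => Z i ^ 2) 0).trans h2
  have hlaw : HasLaw id (gaussianReal 0 Var[X 0; W].toNNReal) (gaussianReal 0 1) := by
    rw [hV, Real.toNNReal_one]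
    exact HasLaw.id
  have hclt := tendstoInDistribution_inv_sqrt_mul_sum_sub hlaw
    (MemLp.of_bound (hX 0).aestronglyMeasurable (∑ i, |Z i|) (ae_of_all _ fun ω =>
      Finset.single_le_sum (f := fun i => |Z i|) (fun i _ => abs_nonneg _) (Finset.mem_univ _)))
    (iIndepFun_infinitePi fun _ => hZ)
    fun i => ⟨(hX i).aemeasurable, (hX 0).aemeasurable, by
      have e : ∀ k, W.map (X k) = m.map Z := fun k => by
        rw [← Measure.infinitePi_map_eval (fun _ : ℕ => m) k,
          Measure.map_map hZ (measurable_pi_apply k)]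
        rfl
      rw [e, e]⟩
  have hfr : (gaussianReal 0 1) (frontier (Set.Iic x)) = 0 := by
    have := nullSingletonClass_gaussianReal (μ := 0) (v := 1) one_ne_zero
    rw [frontier_Iic]
    exact measure_singleton x
  have hport := ProbabilityMeasure.tendsto_measure_of_null_frontier_of_tendsto' hclt.tendsto
    (E := Set.Iic x) (by simpa using hfr)
  simp only [ProbabilityMeasure.coe_mk, Measure.map_id] at hport
  have hlim := (ENNReal.tendsto_toReal (measure_ne_top _ _)).comp hport
  rw [gaussianReal_Iic] at hlim
  refine hlim.congr fun n => ?_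
  have hmeas : Measurable fun ω => (Real.sqrt n)⁻¹ * (∑ k ∈ Finset.range n, X k ω
      - n * ∫ ω, X 0 ω ∂W) :=
    ((Finset.measurable_fun_sum _ fun k _ => hX k).sub_const _).const_mul _
  let r : (ℕ → Fin d) → Fin n → Fin d := fun ω j => ω j
  have hr : Measurable r := measurable_pi_lambda _ fun j => measurable_pi_apply _
  have hmap : W.map r = Measure.infinitePi fun _ : Fin n => m :=
    Measure.map_infinitePi_infinitePi_of_inj (P := fun _ : ℕ => m) Fin.val_injective
  let S : Finset (Fin n → Fin d) := Finset.univ.filter fun f =>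
    (Real.sqrt n)⁻¹ * ∑ j, Z (f j) ≤ x
  have hS : (fun ω => (Real.sqrt n)⁻¹ * (∑ k ∈ Finset.range n, X k ω
      - n * ∫ ω, X 0 ω ∂W)) ⁻¹' Set.Iic x = r ⁻¹' S := by
    ext ω
    simp only [hE, mul_zero, sub_zero, Set.mem_preimage, Set.mem_Iic, S, Finset.coe_filter,
      Finset.mem_univ, true_and, Set.mem_ofPred_eq, X, r,
      Finset.sum_range fun k => Z (ω k)]
  rw [Function.comp_apply, Measure.map_apply hmeas measurableSet_Iic, hS,
    ← Measure.map_apply hr S.measurableSet, hmap, ← Finset.sum_filter]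
  change (Measure.infinitePi fun _ : Fin n => m).real S = _
  rw [← sum_measureReal_singleton]
  refine Finset.sum_congr rfl fun f _ => ?_
  rw [Measure.real, Measure.infinitePi_singleton_of_fintype, ENNReal.toReal_prod]
  exact Finset.prod_congr rfl fun j _ => hm _

lemma upMass_tensorPow_eq (hV : 0 < entVar p) (hp : IsProbVec p) {n : ℕ} (hn : 0 < n) (x : ℝ) :
    upMass (tensorPow p n) (n * shannonH p + x * Real.sqrt (n * entVar p)) =
      ∑ f : Fin n → Fin d, if (Real.sqrt n)⁻¹ *
        ∑ j, (-Real.log (p (f j)) - shannonH p) / Real.sqrt (entVar p) ≤ x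
      then tensorPow p n f else 0 := by
  rw [upMass, upSet, Finset.sum_filter]
  refine Finset.sum_congr rfl fun f _ => ?_
  rcases ((hp.tensorPow n).1 f).eq_or_lt with h0 | h0
  · simp [← h0]
  · have hne : ∀ j ∈ Finset.univ, p (f j) ≠ 0 := Finset.prod_ne_zero_iff.1 h0.ne'
    have hn' : 0 < Real.sqrt n := Real.sqrt_pos.2 (by exact_mod_cast hn)
    have hv := Real.sqrt_pos.2 hV
    have hlog : Real.log (tensorPow p n f) = ∑ j, Real.log (p (f j)) := Real.log_prod hne
    refine if_congr ?_ rfl rfl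
    rw [← Real.le_log_iff_exp_le h0, hlog, ← Finset.sum_div, inv_mul_le_iff₀ hn',
      div_le_iff₀ hv, Finset.sum_sub_distrib, Finset.sum_neg_distrib,
      Real.sqrt_mul (Nat.cast_nonneg n)]
    simp only [Finset.sum_const, Finset.card_univ, Fintype.card_fin, nsmul_eq_mul]
    constructor <;> intro h <;> linarith

lemma tendsto_upMass_tensorPow_mul_add (hp : IsProbVec p) (hV : 0 < entVar p) (x : ℝ) :
    Tendsto (fun n : ℕ => upMass (tensorPow p n)
      (n * shannonH p + x * Real.sqrt (n * entVar p))) atTop (𝓝 (Phi x)) := by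
  have hv := Real.sqrt_pos.2 hV
  have h1 : ∑ i, p i * ((-Real.log (p i) - shannonH p) / Real.sqrt (entVar p)) = 0 := by
    simp only [← mul_div_assoc, ← Finset.sum_div, mul_sub, Finset.sum_sub_distrib,
      ← Finset.sum_mul, hp.2]
    simp [shannonH]
  have h2 : ∑ i, p i * ((-Real.log (p i) - shannonH p) / Real.sqrt (entVar p)) ^ 2 = 1 := by
    simp only [div_pow, Real.sq_sqrt hV.le, ← mul_div_assoc, ← Finset.sum_div]
    exact div_self hV.ne'
  refine (tendsto_sum_tensorPow hp h1 h2 x).congr' ?_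
  filter_upwards [eventually_gt_atTop 0] with n hn
  exact (upMass_tensorPow_eq hV hp hn x).symm

lemma upMass_mono {ι : Type*} [Fintype ι] {P : ι → ℝ} (hP : IsProbVec P) : Monotone (upMass P) :=
  fun _ _ h => Finset.sum_le_sum_of_subset_of_nonneg (upSet_mono P h) fun i _ _ => hP.1 i

lemma tendsto_upMass_tensorPow (hp : IsProbVec p) (hV : 0 < entVar p) {m : ℕ → ℕ}
    (hm : Tendsto m atTop atTop) {s : ℕ → ℝ} {x : ℝ}
    (hs : Tendsto (fun n => (s n - m n * shannonH p) / Real.sqrt (m n * entVar p)) atTop (𝓝 x)) :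
    Tendsto (fun n => upMass (tensorPow p (m n)) (s n)) atTop (𝓝 (Phi x)) := by
  have hbase := fun z => (tendsto_upMass_tensorPow_mul_add hp hV z).comp hm
  have hpos : ∀ᶠ n in atTop, 0 < Real.sqrt (m n * entVar p) := by
    filter_upwards [hm.eventually_gt_atTop 0] with n hn
    exact Real.sqrt_pos.2 (mul_pos (by exact_mod_cast hn) hV)
  have hPhi : Continuous Phi := continuous_normCDF 0 one_pos
  rw [tendsto_order]
  constructor
  · intro a ha
    obtain ⟨z, hz, hzx⟩ : ∃ z, a < Phi z ∧ z < x :=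
      (((hPhi.tendsto x).mono_left nhdsWithin_le_nhds).eventually (eventually_gt_nhds ha)
        |>.and (eventually_mem_nhdsWithin (s := Set.Iio x))).exists
    filter_upwards [(tendsto_order.1 (hbase z)).1 a hz, hpos,
      (tendsto_order.1 hs).1 z hzx] with n h1 h2 h3
    refine h1.trans_le (upMass_mono (hp.tensorPow _) ?_)
    rw [lt_div_iff₀ h2] at h3
    linarith
  · intro b hb
    obtain ⟨z, hz, hzx⟩ : ∃ z, Phi z < b ∧ x < z :=
      (((hPhi.tendsto x).mono_left nhdsWithin_le_nhds).eventually (eventually_lt_nhds hb)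
        |>.and (eventually_mem_nhdsWithin (s := Set.Ioi x))).exists
    filter_upwards [(tendsto_order.1 (hbase z)).2 b hz, hpos,
      (tendsto_order.1 hs).2 z hzx] with n h1 h2 h3
    refine (upMass_mono (hp.tensorPow _) ?_).trans_lt h1
    rw [div_lt_iff₀ h2] at h3
    linarith

end CentralLimit

section Interconversion

open MeasureTheory Topology

lemma IsProbVec.sum_sqrt_mul_le_one {κ : Type*} [Fintype κ] {Q Q' : κ → ℝ} (hQ : IsProbVec Q)
    (hQ' : IsProbVec Q') : ∑ i, Real.sqrt (Q i * Q' i) ≤ 1 := by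
  calc _ ≤ ∑ i, (Q i + Q' i) / 2 := Finset.sum_le_sum fun i _ => by
        have h1 := hQ.1 i
        have h2 := hQ'.1 i
        rw [Real.sqrt_le_left (by positivity)]
        nlinarith [sq_nonneg (Q i - Q' i)]
    _ = 1 := by rw [← Finset.sum_div, Finset.sum_add_distrib, hQ.2, hQ'.2]; norm_num

lemma tendsto_sInf_postMaj {ι κ : ℕ → Type*} [∀ n, Fintype (ι n)] [∀ n, Fintype (κ n)]
    {P : ∀ n, ι n → ℝ} {Q : ∀ n, κ n → ℝ} {T : ℕ → ℝ → ℝ} {μ ν : ℝ}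
    (hP : ∀ n, IsProbVec (P n)) (hQ : ∀ n, IsProbVec (Q n))
    (e : ∀ n, κ n ≃ ι n) (hTm : ∀ n, Monotone (T n))
    (hT : ∀ y z, y < z → Tendsto (fun n => T n z - T n y) atTop atTop) (hν : 0 < ν)
    (hlimP : ∀ y, Tendsto (fun n => upMass (P n) (T n y)) atTop (𝓝 (normCDF μ ν y)))
    (hlimQ : ∀ y, Tendsto (fun n => upMass (Q n) (T n y)) atTop (𝓝 (Phi y))) :
    Tendsto (fun n => sInf {ε : ℝ | ε ∈ Set.Icc (0 : ℝ) 1 ∧ PostMaj ε (P n) (Q n)}) atTop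
      (𝓝 (Zray ν μ)) := by
  obtain ⟨L, hL⟩ := exists_isOptimalRatio μ hν
  set S := ∫ y, Real.sqrt (L y) * normPDF μ ν y
  have hS : 0 ≤ S := integral_nonneg fun y =>
    mul_nonneg (Real.sqrt_nonneg _) (normPDF_pos μ hν y).le
  have upper : ∀ ε > 0, ∀ᶠ n in atTop, ∀ Qt : κ n → ℝ, IsProbVec Qt → Majorises (P n) Qt →
      ∑ i, Real.sqrt (Q n i * Qt i) ≤ S + ε := fun ε hε => by
    obtain ⟨t, v, K, ht, hv, hv0, hlt⟩ := hL.exists_stepSum_lt hν hε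
    exact eventually_fidelity_le hP hQ hTm hT (continuous_normCDF μ hν) hlimP hlimQ ht hv hv0 K hlt
  obtain ⟨A₀, hA, hA1, hA2, hA3, hAS⟩ := hL.exists_eq_integral hν
  have lower : ∀ ε > 0, ∀ᶠ n in atTop, ∃ Qt : κ n → ℝ, IsProbVec Qt ∧ Majorises (P n) Qt ∧
      S - ε ≤ ∑ i, Real.sqrt (Q n i * Qt i) := fun ε hε => by
    have h := eventually_exists_fidelity_ge hP hQ e hTm hT hν hlimP hlimQ hA hA1 hA2 hA3 hε
    rwa [hAS] at h
  have hZ : Zray ν μ = 1 - S ^ 2 := by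
    rw [Zray]
    congr 1
    refine IsGreatest.csSup_eq ⟨⟨A₀, hA, hA1, hA2, hA3, by rw [hAS]⟩, ?_⟩
    rintro _ ⟨A, hA, hA1, hA2, hA3, rfl⟩
    refine pow_le_pow_left₀ (integral_nonneg fun x => Real.sqrt_nonneg _) ?_ 2
    refine le_of_forall_pos_le_add fun ε hε => ?_
    obtain ⟨n, ⟨Qt, h1, h2, h3⟩, h4⟩ := ((eventually_exists_fidelity_ge hP hQ e hTm hT hν hlimP
      hlimQ hA hA1 hA2 hA3 (half_pos hε)).and (upper (ε / 2) (half_pos hε))).exists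
    linarith [h4 Qt h1 h2]
  rw [hZ, Metric.tendsto_nhds]
  intro ε hε
  set γ := min 1 (ε / (2 * (2 * S + 1)))
  have hγ : 0 < γ := lt_min one_pos (by positivity)
  have hγ1 : γ ≤ 1 := min_le_left _ _
  have hγε : γ * (2 * (2 * S + 1)) ≤ ε := (le_div_iff₀ (by positivity)).1 (min_le_right _ _)
  filter_upwards [upper γ hγ, lower γ hγ] with n hu ⟨Qt, h1, h2, h3⟩
  set F := ∑ i, Real.sqrt (Q n i * Qt i)
  have hF0 : 0 ≤ F := Finset.sum_nonneg fun _ _ => Real.sqrt_nonneg _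
  have hF1 : F ≤ 1 := (hQ n).sum_sqrt_mul_le_one h1
  have hmem : 1 - F ^ 2 ∈ {ε : ℝ | ε ∈ Set.Icc (0 : ℝ) 1 ∧ PostMaj ε (P n) (Q n)} :=
    ⟨⟨by nlinarith, by nlinarith⟩, Qt, h1, h2, le_rfl⟩
  have b1 : sInf {ε : ℝ | ε ∈ Set.Icc (0 : ℝ) 1 ∧ PostMaj ε (P n) (Q n)} ≤ 1 - F ^ 2 :=
    csInf_le ⟨0, fun x hx => hx.1.1⟩ hmem
  have b2 : 1 - (S + γ) ^ 2 ≤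
      sInf {ε : ℝ | ε ∈ Set.Icc (0 : ℝ) 1 ∧ PostMaj ε (P n) (Q n)} := by
    refine le_csInf ⟨_, hmem⟩ ?_
    rintro x ⟨-, Qt', g1, g2, g3⟩
    refine le_trans ?_ g3
    have : fidelity (Q n) Qt' ≤ (S + γ) ^ 2 := pow_le_pow_left₀
      (Finset.sum_nonneg fun _ _ => Real.sqrt_nonneg _) (hu Qt' g1 g2) 2
    rw [infid]
    linarith
  have b3 : S ^ 2 - 2 * S * γ ≤ F ^ 2 := by
    rcases le_total S γ with h | h <;> nlinarith
  rw [Real.dist_eq, abs_lt]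
  constructor <;> nlinarith

lemma normCDF_eq_Phi (μ : ℝ) {ν : ℝ} (hν : 0 < ν) (y : ℝ) :
    Phi ((y - μ) / Real.sqrt ν) = normCDF μ ν y := by
  have hs : 0 < Real.sqrt ν := Real.sqrt_pos.2 hν
  have hpdf : ∀ y, normPDF 0 1 ((y - μ) / Real.sqrt ν) * (1 / Real.sqrt ν) = normPDF μ ν y :=
    fun y => by
    rw [normPDF, normPDF, Real.sqrt_mul (by positivity : (0 : ℝ) ≤ 2 * Real.pi) ν, mul_one,
      sub_zero, div_pow, Real.sq_sqrt hν.le, mul_one, div_mul_div_comm, mul_one]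
    congr 2
    field_simp
  have hd : ∀ y, HasDerivAt (fun y => Phi ((y - μ) / Real.sqrt ν) - normCDF μ ν y) 0 y :=
    fun y => by
    have h1 : HasDerivAt (fun y => (y - μ) / Real.sqrt ν) (1 / Real.sqrt ν) y :=
      ((hasDerivAt_id y).sub_const μ).div_const _
    have h2 := ((hasDerivAt_normCDF 0 one_pos ((y - μ) / Real.sqrt ν)).comp y h1).sub
      (hasDerivAt_normCDF μ hν y)
    rwa [hpdf, sub_self] at h2
  have hconst := is_const_of_deriv_eq_zero (fun y => (hd y).differentiableAt)
    fun y => (hd y).deriv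
  have hlim : Tendsto (fun y => Phi ((y - μ) / Real.sqrt ν) - normCDF μ ν y) atBot (𝓝 0) := by
    have h1 : Tendsto (fun y => (y - μ) / Real.sqrt ν) atBot atBot :=
      (tendsto_atBot_add_const_right _ (-μ) tendsto_id).atBot_div_const hs
    have h2 := ((tendsto_normCDF_atBot 0 one_pos).comp h1).sub (tendsto_normCDF_atBot μ hν)
    rw [sub_zero] at h2
    exact h2
  have h0 := tendsto_nhds_unique (tendsto_const_nhds.congr fun z => hconst y z) hlim
  linarith

section Copies

variable {a b c w : ℝ} (μ : ℝ)

lemma tendsto_floor_copies (ha : 0 < a) (hb : 0 < b) (w : ℝ) :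
    Tendsto (fun n : ℕ => ⌊(n : ℝ) * ((1 / b) * (a + μ * Real.sqrt (a * w / (b * n))))⌋₊)
      atTop atTop ∧
    Tendsto (fun n : ℕ => (⌊(n : ℝ) * ((1 / b) * (a + μ * Real.sqrt (a * w / (b * n))))⌋₊ : ℝ) / n)
      atTop (𝓝 (a / b)) := by
  have h0 : Tendsto (fun n : ℕ => (1 / b) * (a + μ * Real.sqrt (a * w / (b * n)))) atTop
      (𝓝 (a / b)) := by
    have h1 : Tendsto (fun n : ℕ => a * w / (b * n)) atTop (𝓝 0) :=
      tendsto_const_nhds.div_atTop (tendsto_natCast_atTop_atTop.const_mul_atTop hb)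
    have h2 := ((h1.sqrt.const_mul μ).const_add a).const_mul (1 / b)
    rw [Real.sqrt_zero, mul_zero, add_zero, one_div_mul_eq_div] at h2
    exact h2
  have hr : Tendsto (fun n : ℕ => (n : ℝ) * ((1 / b) * (a + μ * Real.sqrt (a * w / (b * n)))))
      atTop atTop := tendsto_natCast_atTop_atTop.atTop_mul_pos (div_pos ha hb) h0
  refine ⟨tendsto_nat_floor_atTop.comp hr, ?_⟩
  have h3 := (tendsto_nat_floor_div_atTop.comp hr).mul h0
  rw [one_mul] at h3
  refine h3.congr' ?_
  filter_upwards [hr.eventually_gt_atTop 0, eventually_gt_atTop 0] with n h4 h5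
  have h6 : (0 : ℝ) < n := by exact_mod_cast h5
  have h7 := (mul_pos_iff_of_pos_left h6).1 h4
  rw [Function.comp_apply, div_mul_eq_mul_div, mul_div_mul_right _ _ h7.ne']

lemma tendsto_scaled_threshold (ha : 0 < a) (hb : 0 < b) (hc : 0 < c) (hw : 0 < w) (y : ℝ) :
    Tendsto (fun n : ℕ => (n * a
        - ⌊(n : ℝ) * ((1 / b) * (a + μ * Real.sqrt (a * w / (b * n))))⌋₊ * b + y * Real.sqrt
          (⌊(n : ℝ) * ((1 / b) * (a + μ * Real.sqrt (a * w / (b * n))))⌋₊ * w)) / Real.sqrt (n * c))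
      atTop (𝓝 ((y - μ) / Real.sqrt ((c / a) / (w / b)))) := by
  obtain ⟨hm, hmn⟩ := tendsto_floor_copies μ ha hb w
  set m : ℕ → ℕ := fun n => ⌊(n : ℝ) * ((1 / b) * (a + μ * Real.sqrt (a * w / (b * n))))⌋₊ with hmdef
  set k := Real.sqrt (a * w / (b * c)) with hk
  have hsq : Tendsto (fun n : ℕ => Real.sqrt (n * c)) atTop atTop :=
    Real.tendsto_sqrt_atTop.comp (tendsto_natCast_atTop_atTop.atTop_mul_const hc)
  have h1 : Tendsto (fun n : ℕ => ((n : ℝ) * ((1 / b) * (a + μ * Real.sqrt (a * w / (b * n))))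
      - m n) * b / Real.sqrt (n * c)) atTop (𝓝 0) := by
    refine squeeze_zero_norm' (a := fun n : ℕ => b / Real.sqrt (n * c)) ?_
      (tendsto_const_nhds.div_atTop hsq)
    filter_upwards [hm.eventually_gt_atTop 0] with n hn
    have g1 := Nat.floor_le (Nat.pos_of_floor_pos hn).le
    have g2 := Nat.lt_floor_add_one ((n : ℝ) * ((1 / b) * (a + μ * Real.sqrt (a * w / (b * n)))))
    change (m n : ℝ) ≤ _ at g1
    change _ < (m n : ℝ) + 1 at g2
    have g3 := sub_nonneg.2 g1
    rw [Real.norm_of_nonneg (by positivity)]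
    refine div_le_div_of_nonneg_right ?_ (Real.sqrt_nonneg _)
    nlinarith
  have h2 : Tendsto (fun n : ℕ => y * Real.sqrt (m n / n * (w / c))) atTop (𝓝 (y * k)) := by
    have := ((hmn.mul_const (w / c)).sqrt).const_mul y
    rwa [div_mul_div_comm, ← hk] at this
  have h3 := (h1.add h2).sub_const (μ * k)
  have hlim : 0 + y * k - μ * k = (y - μ) / Real.sqrt ((c / a) / (w / b)) := by
    have : k = 1 / Real.sqrt ((c / a) / (w / b)) := by
      rw [hk, one_div, ← Real.sqrt_inv]
      congr 1
      field_simp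
    rw [this]
    ring
  rw [hlim] at h3
  refine h3.congr' ?_
  filter_upwards [eventually_gt_atTop 0] with n hn
  have hn : (0 : ℝ) < n := by exact_mod_cast hn
  have hnc : 0 < Real.sqrt (n * c) := Real.sqrt_pos.2 (by positivity)
  have e1 : Real.sqrt (m n / n * (w / c)) = Real.sqrt (m n * w) / Real.sqrt (n * c) := by
    rw [div_mul_div_comm, Real.sqrt_div (by positivity)]
  have e2 : k * Real.sqrt (n * c) = n * Real.sqrt (a * w / (b * n)) := by
    rw [hk, ← Real.sqrt_mul (by positivity)]
    nth_rw 2 [← Real.sqrt_sq hn.le]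
    rw [← Real.sqrt_mul (by positivity)]
    congr 1
    field_simp
  have e3 : k = n * Real.sqrt (a * w / (b * n)) / Real.sqrt (n * c) := by
    rw [← e2, mul_div_cancel_right₀ _ hnc.ne']
  change _ = (n * a - m n * b + y * Real.sqrt (m n * w)) / Real.sqrt (n * c)
  rw [e1, e3]
  generalize m n = l
  field_simp
  ring

end Copies

lemma upMass_mul_exp {ι κ : Type*} [Fintype ι] [Fintype κ] (P : ι → ℝ) {u : κ → ℝ} {a : ℝ}
    (hu : ∀ j, u j = Real.exp (-a)) (hu1 : ∑ j, u j = 1) (t : ℝ) :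
    upMass (fun ij : ι × κ => P ij.1 * u ij.2) t = upMass P (t - a) := by
  rw [upMass, upMass, upSet, upSet, Finset.sum_filter, Finset.sum_filter, Fintype.sum_prod_type]
  refine Finset.sum_congr rfl fun i _ => ?_
  have h : ∀ j, (Real.exp (-t) ≤ P i * u j) ↔ Real.exp (-(t - a)) ≤ P i := fun j => by
    rw [hu, ← div_le_iff₀ (Real.exp_pos _), ← Real.exp_sub]
    ring_nf
  simp only [h]
  split_ifs
  · rw [← Finset.mul_sum, hu1, mul_one]
  · simp

lemma IsProbVec.prod {ι κ : Type*} [Fintype ι] [Fintype κ] {P : ι → ℝ} {u : κ → ℝ}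
    (hP : IsProbVec P) (hu : IsProbVec u) : IsProbVec fun ij : ι × κ => P ij.1 * u ij.2 := by
  refine ⟨fun ij => mul_nonneg (hP.1 _) (hu.1 _), ?_⟩
  rw [Fintype.sum_prod_type]
  simp only [← Finset.mul_sum, hu.2, mul_one, hP.2]

lemma tensorPow_uniform {d : ℕ} (hd : 0 < d) (n : ℕ) (f : Fin n → Fin d) :
    tensorPow (fun _ : Fin d => (d : ℝ)⁻¹) n f = Real.exp (-(n * Real.log d)) := by
  have : (0 : ℝ) < d := by exact_mod_cast hd
  rw [tensorPow, Finset.prod_const, Finset.card_univ, Fintype.card_fin, ← mul_neg,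
    Real.exp_nat_mul, Real.exp_neg, Real.exp_log this]

end Interconversion

/-- general bistochastic interconversion: for `D(p), D(q), V(p),
V(q) > 0`, with `R_μ(n) = (1/D(q))[D(p) + μ √(D(p)V(q)/(D(q)n))]` and
`mₙ = ⌊n R_μ(n)⌋`, the optimal interconversion infidelity
`ε*₀(n) = min{ε ∈ [0,1] : p^{⊗n} ⊗ η^{⊗mₙ} ≻_ε q^{⊗mₙ} ⊗ η^{⊗n}}` converges to
`Z_ν(μ)` with `ν = (V(p)/D(p))/(V(q)/D(q))`. -/
theorem bistochastic_interconversion_infidelity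
    {d : ℕ} (p q : Fin d → ℝ) (hp : IsProbVec p) (hq : IsProbVec q)
    (hDp : 0 < relD p) (hDq : 0 < relD q) (hVp : 0 < entVar p) (hVq : 0 < entVar q)
    (μ : ℝ) :
    Filter.Tendsto (fun n : ℕ =>
      sInf {ε : ℝ | ε ∈ Set.Icc (0:ℝ) 1 ∧ PostMaj ε
        (fun fg : (Fin n → Fin d) ×
            (Fin ⌊(n : ℝ) * ((1 / relD q) * (relD p
              + μ * Real.sqrt (relD p * entVar q / (relD q * n))))⌋₊ → Fin d) =>
          tensorPow p n fg.1 * tensorPow (fun _ : Fin d => (d : ℝ)⁻¹) _ fg.2)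
        (fun fg : (Fin ⌊(n : ℝ) * ((1 / relD q) * (relD p
              + μ * Real.sqrt (relD p * entVar q / (relD q * n))))⌋₊ → Fin d) ×
            (Fin n → Fin d) =>
          tensorPow q _ fg.1 * tensorPow (fun _ : Fin d => (d : ℝ)⁻¹) n fg.2)})
      Filter.atTop
      (nhds (Zray ((entVar p / relD p) / (entVar q / relD q)) μ)) := by
  obtain ⟨hm, -⟩ := tendsto_floor_copies μ hDp hDq (entVar q)
  have hscale := tendsto_scaled_threshold μ hDp hDq hVp hVq
  set m : ℕ → ℕ := fun n => ⌊(n : ℝ) * ((1 / relD q) * (relD p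
    + μ * Real.sqrt (relD p * entVar q / (relD q * n))))⌋₊
  have hν : 0 < (entVar p / relD p) / (entVar q / relD q) := by positivity
  have hd : 0 < d := by
    rcases Nat.eq_zero_or_pos d with rfl | h
    · simp [IsProbVec] at hp
    · exact h
  have hd' : (d : ℝ) ≠ 0 := by exact_mod_cast hd.ne'
  have hη : IsProbVec fun _ : Fin d => (d : ℝ)⁻¹ :=
    ⟨fun _ => by positivity, by simp [hd']⟩
  have hexp := fun n => tensorPow_uniform hd n
  refine tendsto_sInf_postMaj (T := fun n y => n * Real.log d + m n * shannonH q
      + y * Real.sqrt (m n * entVar q))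
    (fun n => (hp.tensorPow n).prod (hη.tensorPow (m n)))
    (fun n => (hq.tensorPow (m n)).prod (hη.tensorPow n)) (fun n => Equiv.prodComm _ _)
    (fun n y z h => ?_) (fun y z h => ?_) hν (fun y => ?_) fun y => ?_
  · have := mul_le_mul_of_nonneg_right h (Real.sqrt_nonneg (m n * entVar q))
    simpa using this
  · have h1 : Filter.Tendsto (fun n => Real.sqrt (m n * entVar q)) Filter.atTop Filter.atTop :=
      Real.tendsto_sqrt_atTop.comp
        ((tendsto_natCast_atTop_atTop.comp hm).atTop_mul_const hVq)
    refine (h1.const_mul_atTop (sub_pos.2 h)).congr fun n => ?_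
    ring
  · simp only [upMass_mul_exp _ (hexp _) (hη.tensorPow _).2]
    rw [← normCDF_eq_Phi μ hν]
    refine tendsto_upMass_tensorPow hp hVp tendsto_id ((hscale y).congr fun n => ?_)
    change (n * (Real.log d - shannonH p) - m n * (Real.log d - shannonH q)
      + y * Real.sqrt (m n * entVar q)) / Real.sqrt (n * entVar p) = _
    congr 1
    simp only [id]
    ring
  · simp only [upMass_mul_exp _ (hexp _) (hη.tensorPow _).2]
    refine tendsto_upMass_tensorPow hq hVq hm (tendsto_const_nhds.congr' ?_)
    filter_upwards [hm.eventually_gt_atTop 0] with n hn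
    have : 0 < Real.sqrt (m n * entVar q) :=
      Real.sqrt_pos.2 (mul_pos (by exact_mod_cast hn) hVq)
    rw [eq_div_iff this.ne']
    ring
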